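/- arXiv:1207.6464 — 3 statements merged into one kernel-verified Lean document; each statement's English description precedes it below -/
import Mathlib

section
/- Let a, b > 0 be real numbers and set m = ⌊b⌋ + 1. Then the kernel K is totally positive of order m, i.e. for every integer m' with 1 ≤ m' ≤ m and all reals 0 < x₁ < … < x_{m'} and 0 < y₁ < … < y_{m'}, one has det[K(x_i, y_j)]_{1≤i,j≤m'} ≥ 0. -/
/-- The multiplicative convolution kernel associated with the Beta(a,b) distribution. -/
noncomputable def betaKernel (a b x y : ℝ) : ℝ :=
  if 0 < x / y ∧ x / y < 1 then (x / y) ^ (a - 1) * (1 - x / y) ^ (b - 1) else 0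

open Filter Topology Set

/-- The truncated power `z₊ ^ α`, with value `0` at every `z ≤ 0`. -/
noncomputable def truncPow (α z : ℝ) : ℝ := if 0 < z then z ^ α else 0

theorem truncPow_of_pos {α z : ℝ} (hz : 0 < z) : truncPow α z = z ^ α := if_pos hz

theorem truncPow_of_nonpos {α z : ℝ} (hz : z ≤ 0) : truncPow α z = 0 := if_neg hz.not_gt

theorem truncPow_nonneg (α z : ℝ) : 0 ≤ truncPow α z := by
  unfold truncPow
  split_ifs with h
  · exact Real.rpow_nonneg h.le _
  · exact le_rfl

theorem truncPow_div {α u v : ℝ} (hv : 0 < v) :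
    truncPow α (u / v) = truncPow α u / v ^ α := by
  rcases lt_or_ge 0 u with hu | hu
  · rw [truncPow_of_pos (div_pos hu hv), truncPow_of_pos hu, Real.div_rpow hu.le hv.le]
  · rw [truncPow_of_nonpos (div_nonpos_of_nonpos_of_nonneg hu hv.le), truncPow_of_nonpos hu,
      zero_div]

theorem continuous_truncPow_exponent (z : ℝ) : Continuous fun α => truncPow α z := by
  rcases lt_or_ge 0 z with hz | hz
  · simp only [truncPow_of_pos hz]
    exact Real.continuous_const_rpow hz.ne'
  · simp only [truncPow_of_nonpos hz]
    exact continuous_const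

theorem hasDerivAt_truncPow {α : ℝ} (hα : 1 < α) (z : ℝ) :
    HasDerivAt (truncPow α) (α * truncPow (α - 1) z) z := by
  rcases lt_trichotomy z 0 with hz | rfl | hz
  · rw [truncPow_of_nonpos hz.le, mul_zero]
    refine (hasDerivAt_const z (0 : ℝ)).congr_of_eventuallyEq ?_
    filter_upwards [Iio_mem_nhds hz] with w hw using truncPow_of_nonpos (le_of_lt hw)
  · rw [truncPow_of_nonpos le_rfl, mul_zero, ← hasDerivWithinAt_univ, ← Iic_union_Ici (a := (0:ℝ))]
    refine HasDerivWithinAt.union ?_ ?_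
    · exact (hasDerivWithinAt_const (0 : ℝ) (Iic 0) (0 : ℝ)).congr
        (fun w hw => truncPow_of_nonpos hw) (truncPow_of_nonpos le_rfl)
    · have h0 : truncPow α 0 = (0 : ℝ) ^ α := by
        rw [truncPow_of_nonpos le_rfl, Real.zero_rpow (by linarith)]
      have h := (Real.hasDerivAt_rpow_const (x := 0) (p := α) (Or.inr hα.le)).hasDerivWithinAt
        (s := Ici 0)
      rw [Real.zero_rpow (by linarith), mul_zero] at h
      refine h.congr (fun w hw => ?_) h0
      rcases (mem_Ici.1 hw).eq_or_lt with rfl | hw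
      · exact h0
      · exact truncPow_of_pos hw
  · rw [truncPow_of_pos hz]
    refine (Real.hasDerivAt_rpow_const (Or.inl hz.ne')).congr_of_eventuallyEq ?_
    filter_upwards [Ioi_mem_nhds hz] with w hw using truncPow_of_pos hw

/-- If the derivatives have nonnegative determinants at all increasing tuples, then so do the
increments over consecutive intervals. -/
theorem det_increments_nonneg {n : ℕ} {G G' : Fin n → ℝ → ℝ} {c : ℝ}
    (hG : ∀ i, ∀ t, c < t → HasDerivAt (G i) (G' i t) t)
    (hdet : ∀ s : Fin n → ℝ, StrictMono s → (∀ j, c < s j) →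
      0 ≤ (Matrix.of fun i j => G' i (s j)).det)
    (y : Fin (n + 1) → ℝ) (hy : StrictMono y) (hc : ∀ j, c < y j) :
    0 ≤ (Matrix.of fun i j : Fin n => G i (y j.succ) - G i (y j.castSucc)).det := by
  classical
  have key : ∀ T : Finset (Fin n), ∀ s : Fin n → ℝ,
      (∀ j, s j ∈ Ioo (y j.castSucc) (y j.succ)) →
      0 ≤ (Matrix.of fun i j : Fin n =>
        if j ∈ T then G i (y j.succ) - G i (y j.castSucc) else G' i (s j)).det := by
    intro T
    induction T using Finset.induction_on with
    | empty =>
      intro s hs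
      simp only [Finset.notMem_empty, if_false]
      refine hdet s (fun j k hjk => ?_) (fun j => (hc _).trans (hs j).1)
      exact ((hs j).2.trans_le (hy.monotone (Fin.succ_le_castSucc_iff.2 hjk))).trans (hs k).1
    | insert j₀ T hj₀ ih =>
      intro s hs
      set M : Matrix (Fin n) (Fin n) ℝ := Matrix.of fun i j : Fin n =>
        if j ∈ T then G i (y j.succ) - G i (y j.castSucc) else G' i (s j) with hM
      let L : (Fin n → ℝ) →ₗ[ℝ] ℝ := (LinearMap.proj j₀).comp M.cramer
      have hL : ∀ v, L v = (M.updateCol j₀ v).det := fun v => Matrix.cramer_apply M v j₀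
      have hderiv : ∀ t, c < t →
          HasDerivAt (fun t => L fun i => G i t) (L fun i => G' i t) t := fun t ht =>
        HasFDerivAt.comp_hasDerivAt (f := fun t i => G i t) t
          (LinearMap.toContinuousLinearMap L).hasFDerivAt (hasDerivAt_pi.2 fun i => hG i t ht)
      have hpos : ∀ t ∈ Ioo (y j₀.castSucc) (y j₀.succ), 0 ≤ L fun i => G' i t := by
        intro t ht
        rw [hL]
        have := ih (Function.update s j₀ t) (fun j => by
          rcases eq_or_ne j j₀ with rfl | h
          · simpa using ht
          · simpa [h] using hs j)
        refine this.trans_eq (congrArg Matrix.det ?_)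
        ext i j
        rcases eq_or_ne j j₀ with rfl | h
        · simp [hj₀]
        · simp [h, hM]
      have hmono : MonotoneOn (fun t => L fun i => G i t)
          (Icc (y j₀.castSucc) (y j₀.succ)) := by
        refine monotoneOn_of_deriv_nonneg (convex_Icc _ _)
          (fun t ht => (hderiv t ((hc _).trans_le ht.1)).continuousAt.continuousWithinAt)
          (fun t ht => ?_) (fun t ht => ?_) <;> rw [interior_Icc] at ht
        · exact (hderiv t ((hc _).trans ht.1)).differentiableAt.differentiableWithinAt
        · rw [(hderiv t ((hc _).trans ht.1)).deriv]
          exact hpos t ht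
      have hlt : y j₀.castSucc ≤ y j₀.succ := (hy Fin.castSucc_lt_succ).le
      have h := sub_nonneg.2 (hmono (left_mem_Icc.2 hlt) (right_mem_Icc.2 hlt) hlt)
      simp only [← map_sub] at h
      rw [hL] at h
      refine h.trans_eq (congrArg Matrix.det ?_)
      ext i j
      rcases eq_or_ne j j₀ with rfl | hj
      · simp
      · simp [hj, hM]
  have := key Finset.univ (fun j => (y j.castSucc + y j.succ) / 2) fun j => by
    have := hy (Fin.castSucc_lt_succ (i := j))
    constructor <;> linarith
  simpa using this

theorem det_eq_det_increments_of_row_zero_eq_one {n : ℕ}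
    (A : Matrix (Fin (n + 1)) (Fin (n + 1)) ℝ) (h : ∀ j, A 0 j = 1) :
    A.det = (Matrix.of fun i j : Fin n => A i.succ j.succ - A i.succ j.castSucc).det := by
  let B : Matrix (Fin (n + 1)) (Fin (n + 1)) ℝ :=
    Matrix.of fun i => Fin.cons (A i 0) fun j => A i j.succ - A i j.castSucc
  have hAB : A.det = B.det :=
    Matrix.det_eq_of_forall_col_eq_smul_add_pred (fun _ => 1) (fun i => by simp [B])
      (fun i j => by simp [B])
  rw [hAB, Matrix.det_succ_row_zero, Fin.sum_univ_succ]
  simp [B, h, Matrix.submatrix]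

theorem det_truncPow_two_nonneg {α x₀ x₁ y₀ y₁ : ℝ} (hα : 0 ≤ α) (hx : x₀ < x₁) (hy : y₀ < y₁) :
    truncPow α (y₀ - x₁) * truncPow α (y₁ - x₀) ≤
      truncPow α (y₀ - x₀) * truncPow α (y₁ - x₁) := by
  rcases le_or_gt y₀ x₁ with h | h
  · rw [truncPow_of_nonpos (sub_nonpos.2 h), zero_mul]
    exact mul_nonneg (truncPow_nonneg _ _) (truncPow_nonneg _ _)
  · have h1 : 0 < y₀ - x₁ := by linarith
    have h2 : 0 < y₁ - x₀ := by linarith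
    have h3 : 0 < y₀ - x₀ := by linarith
    have h4 : 0 < y₁ - x₁ := by linarith
    rw [truncPow_of_pos h1, truncPow_of_pos h2, truncPow_of_pos h3, truncPow_of_pos h4,
      ← Real.mul_rpow h1.le h2.le, ← Real.mul_rpow h3.le h4.le]
    refine Real.rpow_le_rpow (mul_pos h1 h2).le ?_ hα
    nlinarith [mul_pos (sub_pos.2 hx) (sub_pos.2 hy)]

theorem det_truncPow_nonneg_of_lt (n : ℕ) : ∀ α : ℝ, (n : ℝ) - 1 < α →
    ∀ x y : Fin (n + 1) → ℝ, StrictMono x → StrictMono y →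
      0 ≤ (Matrix.of fun i j => truncPow α (y j - x i)).det := by
  induction n with
  | zero =>
    intro α _ x y _ _
    simpa using truncPow_nonneg _ _
  | succ n ih =>
    intro α hα x y hx hy
    push_cast at hα
    rcases Nat.eq_zero_or_pos n with rfl | hn
    · rw [Matrix.det_fin_two]
      simp only [Matrix.of_apply]
      have := det_truncPow_two_nonneg (α := α) (by simpa using hα.le)
        (hx (show (0 : Fin 2) < 1 by decide)) (hy (show (0 : Fin 2) < 1 by decide))
      linarith
    have hα1 : 1 < α := by
      have : (1 : ℝ) ≤ n := by exact_mod_cast hn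
      linarith
    rcases le_or_gt (y 0) (x 0) with h0 | h0
    · refine (Matrix.det_eq_zero_of_column_eq_zero 0 fun i => ?_).ge
      exact truncPow_of_nonpos (sub_nonpos.2 (h0.trans (hx.monotone (Fin.zero_le i))))
    have hyx : ∀ j, x 0 < y j := fun j => h0.trans_le (hy.monotone (Fin.zero_le j))
    have hscale : (Matrix.of fun i j => truncPow α (y j - x i)) =
        Matrix.of fun i j => (y j - x 0) ^ α *
          (Matrix.of fun i j => truncPow α ((y j - x i) / (y j - x 0))) i j := by
      ext i j
      have hpos := sub_pos.2 (hyx j)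
      simp only [Matrix.of_apply]
      rw [truncPow_div hpos, mul_div_cancel₀ _ (Real.rpow_pos_of_pos hpos _).ne']
    rw [hscale, Matrix.det_mul_row]
    refine mul_nonneg
      (Finset.prod_nonneg fun j _ => Real.rpow_nonneg (sub_pos.2 (hyx j)).le _) ?_
    rw [det_eq_det_increments_of_row_zero_eq_one _ fun j => by
      have hpos := sub_pos.2 (hyx j)
      simp [div_self hpos.ne', truncPow]]
    refine det_increments_nonneg (c := x 0)
      (G := fun i t => truncPow α ((t - x i.succ) / (t - x 0)))
      (G' := fun i t => (x i.succ - x 0) *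
        (α / ((t - x 0) ^ (α - 1) * (t - x 0) ^ 2) * truncPow (α - 1) (t - x i.succ)))
      (fun i t ht => ?_) (fun s hs hsc => ?_) y hy hyx
    · have hpos := sub_pos.2 ht
      have h1 : HasDerivAt (fun t => (t - x i.succ) / (t - x 0))
          ((1 * (t - x 0) - (t - x i.succ) * 1) / (t - x 0) ^ 2) t :=
        ((hasDerivAt_id t).sub_const _).div ((hasDerivAt_id t).sub_const _) hpos.ne'
      refine ((hasDerivAt_truncPow hα1 _).comp t h1).congr_deriv ?_
      rw [truncPow_div hpos]
      have := (Real.rpow_pos_of_pos hpos (α - 1)).ne'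
      field_simp
      ring
    · have hrow := Matrix.det_mul_column (fun i : Fin (n + 1) => x i.succ - x 0)
        (Matrix.of fun i j => α / ((s j - x 0) ^ (α - 1) * (s j - x 0) ^ 2) *
          (Matrix.of fun i j => truncPow (α - 1) (s j - x i.succ)) i j)
      rw [Matrix.det_mul_row] at hrow
      simp only [Matrix.of_apply] at hrow
      rw [hrow]
      refine mul_nonneg
        (Finset.prod_nonneg fun i _ => (sub_pos.2 (hx (Fin.succ_pos i))).le)
        (mul_nonneg (Finset.prod_nonneg fun j _ => ?_) ?_)
      · have hpos := sub_pos.2 (hsc j)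
        positivity
      · exact ih (α - 1) (by linarith) (fun i => x i.succ) s
          (hx.comp (Fin.strictMono_succ)) hs

theorem det_truncPow_nonneg {n : ℕ} {α : ℝ} (hα : (n : ℝ) - 1 ≤ α)
    {x y : Fin (n + 1) → ℝ} (hx : StrictMono x) (hy : StrictMono y) :
    0 ≤ (Matrix.of fun i j => truncPow α (y j - x i)).det := by
  have hcont : Continuous fun β => (Matrix.of fun i j => truncPow β (y j - x i)).det :=
    Continuous.matrix_det (continuous_matrix fun i j => continuous_truncPow_exponent _)
  refine ge_of_tendsto (hcont.continuousAt.tendsto.mono_left nhdsWithin_le_nhds :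
    Tendsto _ (𝓝[>] α) _) ?_
  filter_upwards [self_mem_nhdsWithin] with β hβ
  exact det_truncPow_nonneg_of_lt n β (hα.trans_lt hβ) x y hx hy

theorem betaKernel_eq_mul_truncPow (a b : ℝ) {x y : ℝ} (hx : 0 < x) (hy : 0 < y) :
    betaKernel a b x y =
      x ^ (a - 1) * ((y ^ (a - 1) * y ^ (b - 1))⁻¹ * truncPow (b - 1) (y - x)) := by
  rcases lt_or_ge x y with h | h
  · have h1 : 1 - x / y = (y - x) / y := by field_simp
    rw [betaKernel, if_pos ⟨div_pos hx hy, (div_lt_one hy).2 h⟩, truncPow_of_pos (sub_pos.2 h), h1,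
      Real.div_rpow hx.le hy.le, Real.div_rpow (sub_pos.2 h).le hy.le, mul_inv]
    ring
  · rw [betaKernel, if_neg fun h' => ((div_lt_one hy).1 h'.2).not_ge h,
      truncPow_of_nonpos (sub_nonpos.2 h), mul_zero, mul_zero]

/-- The Beta(a,b) multiplicative kernel is totally positive of order `⌊b⌋ + 1`. -/
theorem betaKernel_totallyPositive (a b : ℝ) (ha : 0 < a) (hb : 0 < b)
    (m' : ℕ) (hm'1 : 1 ≤ m') (hm'2 : m' ≤ Nat.floor b + 1)
    (x y : Fin m' → ℝ) (hx : StrictMono x) (hy : StrictMono y)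
    (hxpos : ∀ i, 0 < x i) (hypos : ∀ i, 0 < y i) :
    0 ≤ Matrix.det (Matrix.of fun i j => betaKernel a b (x i) (y j)) := by
  obtain ⟨n, rfl⟩ : ∃ n, m' = n + 1 := ⟨m' - 1, by omega⟩
  have hn : (n : ℝ) ≤ b := (Nat.le_floor_iff hb.le).1 (by omega)
  have hrow := Matrix.det_mul_column (fun i => x i ^ (a - 1))
    (Matrix.of fun i j => (y j ^ (a - 1) * y j ^ (b - 1))⁻¹ *
      (Matrix.of fun i j => truncPow (b - 1) (y j - x i)) i j)
  rw [Matrix.det_mul_row] at hrow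
  simp only [Matrix.of_apply] at hrow
  simp only [betaKernel_eq_mul_truncPow a b (hxpos _) (hypos _)]
  rw [hrow]
  refine mul_nonneg (Finset.prod_nonneg fun i _ => Real.rpow_nonneg (hxpos i).le _)
    (mul_nonneg (Finset.prod_nonneg fun j _ => ?_) (det_truncPow_nonneg (by linarith) hx hy))
  have := hypos j
  positivity
end

section
/- Let b > 0 and d ∈ ℝ. If b is a positive integer or d is a nonnegative integer, then the kernel T_{b,d} is totally positive of every order: for every m ≥ 1 and all reals 0 < x₁ < … < x_m and 0 < y₁ < … < y_m, det[T_{b,d}(x_i, y_j)]_{1≤i,j≤m} ≥ 0. -/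
/-- `f b ν z = Ψ(b, b+1-ν, z)`, the Tricomi confluent hypergeometric function,
given by its integral representation. -/
noncomputable def tricomiF (b ν z : ℝ) : ℝ :=
  (1 / Real.Gamma b) * ∫ t in Set.Ioi (0:ℝ), Real.exp (-t * z) * t ^ (b - 1) * (1 + t) ^ (-ν)

/-- The kernel `T_{b,d}(x,y) = e^{-x/y} Ψ(b, b+1-d, x/y)`. -/
noncomputable def kernelT (b d x y : ℝ) : ℝ :=
  Real.exp (-(x / y)) * tricomiF b d (x / y)

open MeasureTheory Set

/-- The determinant of a matrix whose columns are integrated against separate measures is the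
integral of the determinant against the product measure. -/
lemma det_of_integral_eq {m : ℕ} (G : Fin m → ℝ → ℝ) (μ : Fin m → Measure ℝ)
    [∀ j, SigmaFinite (μ j)] (hG : ∀ i j, Integrable (G i) (μ j)) :
    Matrix.det (Matrix.of fun i j => ∫ w, G i w ∂(μ j)) =
      ∫ w : Fin m → ℝ, Matrix.det (Matrix.of fun i j => G i (w j)) ∂(Measure.pi μ) := by
  simp only [Matrix.det_apply, Matrix.of_apply, Units.smul_def, zsmul_eq_mul]
  rw [integral_finsetSum]
  · refine Finset.sum_congr rfl fun σ _ => ?_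
    rw [integral_const_mul, integral_fintype_prod_eq_prod (fun i => G (σ i))]
  · intro σ _
    exact (Integrable.fintype_prod (f := fun i => G (σ i)) fun i => hG _ _).const_mul _

lemma det_of_integral_nonneg {m : ℕ} (G : Fin m → ℝ → ℝ) (μ : Fin m → Measure ℝ)
    [∀ j, SigmaFinite (μ j)] (hG : ∀ i j, Integrable (G i) (μ j)) (S : Fin m → Set ℝ)
    (hS : ∀ j, ∀ᵐ w ∂(μ j), w ∈ S j)
    (hdet : ∀ w : Fin m → ℝ, (∀ j, w j ∈ S j) →
      0 ≤ Matrix.det (Matrix.of fun i j => G i (w j))) :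
    0 ≤ Matrix.det (Matrix.of fun i j => ∫ w, G i w ∂(μ j)) := by
  rw [det_of_integral_eq G μ hG]
  refine integral_nonneg_of_ae ?_
  have h : ∀ᵐ w ∂(Measure.pi μ), ∀ j, w j ∈ S j :=
    ae_all_iff.2 fun j => Measure.tendsto_eval_ae_ae (hS j)
  filter_upwards [h] with w hw using hdet w hw

lemma det_exp_mul_nonneg (m : ℕ) : ∀ x a : Fin m → ℝ, StrictMono x → StrictMono a →
    0 ≤ Matrix.det (Matrix.of fun i j => Real.exp (x i * a j)) := by
  induction m with
  | zero => intro x a _ _; simp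
  | succ m ih =>
    intro x a hx ha
    set c : Fin (m + 1) → ℝ := fun j => a j - a 0 with hc
    have hsplit : (Matrix.of fun i j => Real.exp (x i * a j)) =
        Matrix.of fun i j => Real.exp (x i * a 0) *
          (Matrix.of fun i j => Real.exp (x i * c j)) i j := by
      ext i j
      simp only [Matrix.of_apply, hc, ← Real.exp_add]
      ring_nf
    rw [hsplit, Matrix.det_mul_column]
    refine mul_nonneg (Finset.prod_nonneg fun i _ => (Real.exp_pos _).le) ?_
    set B : Matrix (Fin (m + 1)) (Fin (m + 1)) ℝ := Matrix.of fun i j =>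
      Fin.cases (motive := fun _ => ℝ) (Real.exp (x 0 * c j))
        (fun i => Real.exp (x i.succ * c j) - Real.exp (x i.castSucc * c j)) i with hB
    rw [Matrix.det_eq_of_forall_row_eq_smul_add_pred (B := B) (fun _ => 1)
      (fun j => by simp [hB]) (fun i j => by simp [hB]), Matrix.det_succ_column_zero,
      Fin.sum_univ_succ]
    have hc0 : c 0 = 0 := by simp [hc]
    have hB0 : B 0 0 = 1 := by simp [hB, hc0]
    have hBs : ∀ i : Fin m, B i.succ 0 = 0 := fun i => by simp [hB, hc0]
    simp only [hB0, hBs, Fin.val_zero, pow_zero, one_mul, mul_zero, zero_mul,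
      Finset.sum_const_zero, add_zero]
    have hpos : ∀ j : Fin m, 0 < c j.succ := fun j => sub_pos.2 (ha (Fin.succ_pos j))
    rw [← Matrix.det_transpose]
    have key : (B.submatrix (Fin.succAbove 0) Fin.succ).transpose =
        Matrix.of fun j i => ∫ s, c j.succ * Real.exp (s * c j.succ)
          ∂(volume.restrict (Ioc (x i.castSucc) (x i.succ))) := by
      ext j i
      have hle : x i.castSucc ≤ x i.succ := (hx i.castSucc_lt_succ).le
      simp only [Matrix.transpose_apply, Matrix.submatrix_apply, Fin.zero_succAbove,
        Matrix.of_apply, hB, Fin.cases_succ]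
      rw [← intervalIntegral.integral_of_le hle]
      symm
      refine intervalIntegral.integral_eq_sub_of_hasDerivAt (f := fun s => Real.exp (s * c j.succ))
        (fun s _ => ?_) (Continuous.intervalIntegrable (by fun_prop) _ _)
      have := ((hasDerivAt_id s).mul_const (c j.succ)).exp
      simpa [mul_comm] using this
    rw [key]
    refine det_of_integral_nonneg (fun j s => c j.succ * Real.exp (s * c j.succ))
      (fun i => volume.restrict (Ioc (x i.castSucc) (x i.succ)))
      (fun j i => (Continuous.integrableOn_Ioc (by fun_prop)))
      (fun i => Ioc (x i.castSucc) (x i.succ))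
      (fun i => ae_restrict_mem measurableSet_Ioc) ?_
    intro s hs
    have hsmono : StrictMono s := by
      intro i j hij
      refine (hs i).2.trans_lt (lt_of_le_of_lt (hx.monotone ?_) (hs j).1)
      exact Fin.succ_le_castSucc_iff.2 hij
    have hmat := Matrix.det_mul_column (fun j : Fin m => c j.succ)
      (Matrix.of fun j i => Real.exp (s i * c j.succ))
    simp only [Matrix.of_apply] at hmat
    rw [hmat]
    refine mul_nonneg (Finset.prod_nonneg fun j _ => (hpos j).le) ?_
    rw [← Matrix.det_transpose]
    refine ih s (fun j => c j.succ) hsmono ?_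
    intro i j hij
    exact sub_lt_sub_right (ha (Fin.succ_lt_succ_iff.2 hij)) _

/-- Total positivity of every order on `(0,∞) × (0,∞)`. -/
def TotallyPositive (K : ℝ → ℝ → ℝ) : Prop :=
  ∀ (m : ℕ) (x y : Fin m → ℝ), StrictMono x → StrictMono y → (∀ i, 0 < x i) → (∀ i, 0 < y i) →
    0 ≤ Matrix.det (Matrix.of fun i j => K (x i) (y j))

lemma TotallyPositive.of_eq_mul {K L : ℝ → ℝ → ℝ} (hK : TotallyPositive K) (p q : ℝ → ℝ)
    (hp : ∀ x, 0 < x → 0 ≤ p x) (hq : ∀ y, 0 < y → 0 ≤ q y)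
    (hL : ∀ x y, 0 < x → 0 < y → L x y = p x * (q y * K x y)) : TotallyPositive L := by
  intro m x y hx hy hx0 hy0
  have h : (Matrix.of fun i j => L (x i) (y j)) =
      Matrix.of fun i j => p (x i) * (Matrix.of fun i j => q (y j) *
        (Matrix.of fun i j => K (x i) (y j)) i j) i j := by
    ext i j
    simp [hL _ _ (hx0 i) (hy0 j)]
  rw [h, Matrix.det_mul_column, Matrix.det_mul_row (fun j => q (y j))]
  exact mul_nonneg (Finset.prod_nonneg fun i _ => hp _ (hx0 i))
    (mul_nonneg (Finset.prod_nonneg fun i _ => hq _ (hy0 i)) (hK m x y hx hy hx0 hy0))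

lemma totallyPositive_exp_neg_div : TotallyPositive fun x y => Real.exp (-(x / y)) := by
  intro m x y hx hy _ hy0
  have h := det_exp_mul_nonneg m x (fun j => -(y j)⁻¹) hx
    fun i j hij => neg_lt_neg (inv_strictAnti₀ (hy0 i) (hy hij))
  simpa [div_eq_mul_inv] using h

lemma TotallyPositive.integral_Ioc {K : ℝ → ℝ → ℝ} (hK : TotallyPositive K)
    (hint : ∀ x y, 0 < x → 0 < y → IntegrableOn (K x) (Ioc 0 y)) :
    TotallyPositive fun x y => ∫ w in Ioc 0 y, K x w := by
  rintro (_ | m) x y hx hy hx0 hy0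
  · simp
  set z : Fin (m + 1) → ℝ := Fin.cons 0 (fun j : Fin m => y j.castSucc) with hz
  have hz0 : ∀ j, 0 ≤ z j := by
    intro j
    refine Fin.cases ?_ (fun j => ?_) j
    · simp [hz]
    · simpa [hz] using (hy0 j.castSucc).le
  rw [Matrix.det_eq_of_forall_col_eq_smul_add_pred
    (B := Matrix.of fun i j => ∫ w, K (x i) w ∂(volume.restrict (Ioc (z j) (y j))))
    (fun _ => 1) (fun i => by simp [hz]) (fun i j => ?_)]
  · refine det_of_integral_nonneg (fun i => K (x i)) (fun j => volume.restrict (Ioc (z j) (y j)))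
      (fun i j => (hint _ _ (hx0 i) (hy0 j)).mono_set (Ioc_subset_Ioc_left (hz0 j)))
      (fun j => Ioc (z j) (y j)) (fun i => ae_restrict_mem measurableSet_Ioc) ?_
    intro w hw
    refine hK _ x w hx ?_ hx0 fun j => (hz0 j).trans_lt (hw j).1
    intro i j hij
    refine (hw i).2.trans_lt (lt_of_le_of_lt ?_ (hw j).1)
    obtain ⟨k, rfl⟩ := Fin.exists_succ_eq.2 (Fin.ne_zero_of_lt hij)
    simp only [hz, Fin.cons_succ]
    exact hy.monotone (Fin.le_castSucc_iff.2 hij)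
  · have hle : y j.castSucc ≤ y j.succ := (hy j.castSucc_lt_succ).le
    have hI := hint _ _ (hx0 i) (hy0 j.succ)
    simp only [Matrix.of_apply, hz, Fin.cons_succ, one_mul]
    rw [← Ioc_union_Ioc_eq_Ioc (hy0 j.castSucc).le hle,
      setIntegral_union (Ioc_disjoint_Ioc_of_le le_rfl) measurableSet_Ioc
        (hI.mono_set (Ioc_subset_Ioc_right hle))
        (hI.mono_set (Ioc_subset_Ioc_left (hy0 j.castSucc).le)), add_comm]

/-- Integrating `y ↦ ∫₀^y g(w) (y - w)^k dw` raises the exponent `k` by one. -/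
lemma integral_Ioc_integral_mul_sub_pow {g : ℝ → ℝ} {Y : ℝ} (hY : 0 < Y)
    (hg : IntegrableOn g (Ioc 0 Y)) (k : ℕ) :
    IntegrableOn (fun y => ∫ w in Ioc 0 y, g w * (y - w) ^ k) (Ioc 0 Y) ∧
    ∫ y in Ioc 0 Y, ∫ w in Ioc 0 y, g w * (y - w) ^ k =
      (1 / (k + 1)) * ∫ w in Ioc 0 Y, g w * (Y - w) ^ (k + 1) := by
  set H : ℝ → ℝ → ℝ := fun y w => (if w ≤ y then (y - w) ^ k else 0) * g w with hH
  have hprod : Integrable (Function.uncurry H)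
      ((volume.restrict (Ioc 0 Y)).prod (volume.restrict (Ioc 0 Y))) := by
    have hg' : Integrable (fun p : ℝ × ℝ => (fun _ => (1 : ℝ)) p.1 * g p.2)
        ((volume.restrict (Ioc 0 Y)).prod (volume.restrict (Ioc 0 Y))) :=
      Integrable.mul_prod (integrable_const _) hg
    simp only [one_mul] at hg'
    refine Integrable.bdd_mul (c := Y ^ k)
      (f := fun p : ℝ × ℝ => if p.2 ≤ p.1 then (p.1 - p.2) ^ k else 0) hg' ?_ ?_
    · refine (Measurable.ite (measurableSet_le measurable_snd measurable_fst) ?_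
        measurable_const).aestronglyMeasurable
      fun_prop
    · rw [Measure.prod_restrict]
      refine (ae_restrict_mem (measurableSet_Ioc.prod measurableSet_Ioc)).mono ?_
      rintro ⟨y, w⟩ ⟨hy, hw⟩
      simp only [mem_Ioc] at hy hw
      dsimp only
      split_ifs with h
      · rw [Real.norm_of_nonneg (pow_nonneg (sub_nonneg.2 h) _)]
        exact pow_le_pow_left₀ (sub_nonneg.2 h) (by linarith) _
      · simp only [norm_zero]; positivity
  have hinner : ∀ y ∈ Ioc 0 Y,
      ∫ w in Ioc 0 Y, H y w = ∫ w in Ioc 0 y, g w * (y - w) ^ k := by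
    intro y hy
    have hind : ∀ w, w ∈ Ioc 0 Y →
        H y w = (Iic y).indicator (fun w => g w * (y - w) ^ k) w := by
      intro w _
      by_cases h : w ≤ y <;> simp [hH, h, mul_comm]
    rw [setIntegral_congr_fun measurableSet_Ioc hind, setIntegral_indicator measurableSet_Iic]
    congr 2
    ext w
    simp only [mem_inter_iff, mem_Ioc, mem_Iic]
    constructor
    · rintro ⟨⟨h1, _⟩, h3⟩; exact ⟨h1, h3⟩
    · rintro ⟨h1, h2⟩; exact ⟨⟨h1, h2.trans hy.2⟩, h2⟩
  have hinner' : ∀ w ∈ Ioc 0 Y,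
      ∫ y in Ioc 0 Y, H y w = (1 / (k + 1)) * (g w * (Y - w) ^ (k + 1)) := by
    intro w hw
    have hind : ∀ y, y ∈ Ioc 0 Y →
        H y w = (Ici w).indicator (fun y => (y - w) ^ k * g w) y := by
      intro y _
      by_cases h : w ≤ y <;> simp [hH, h]
    rw [setIntegral_congr_fun measurableSet_Ioc hind, setIntegral_indicator measurableSet_Ici]
    have hset : Ioc 0 Y ∩ Ici w = Icc w Y := by
      ext y
      simp only [mem_inter_iff, mem_Ioc, mem_Ici, mem_Icc]
      constructor
      · rintro ⟨⟨_, h2⟩, h3⟩; exact ⟨h3, h2⟩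
      · rintro ⟨h1, h2⟩; exact ⟨⟨hw.1.trans_le h1, h2⟩, h1⟩
    rw [hset, integral_Icc_eq_integral_Ioc, ← intervalIntegral.integral_of_le hw.2,
      intervalIntegral.integral_mul_const,
      intervalIntegral.integral_comp_sub_right (fun t => t ^ k), integral_pow]
    simp
    ring
  refine ⟨?_, ?_⟩
  · exact IntegrableOn.congr_fun hprod.integral_prod_left hinner measurableSet_Ioc
  · rw [← setIntegral_congr_fun measurableSet_Ioc hinner, integral_integral_swap hprod,
      setIntegral_congr_fun measurableSet_Ioc hinner', integral_const_mul]

lemma integrableOn_exp_neg_div_mul_rpow {x y : ℝ} (hx : 0 < x) (γ : ℝ) :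
    IntegrableOn (fun w => Real.exp (-(x / w)) * w ^ γ) (Ioc 0 y) := by
  obtain ⟨n, hn⟩ := exists_nat_ge (-γ)
  have hmeas : AEStronglyMeasurable (fun w : ℝ => Real.exp (-(x / w)) * w ^ γ)
      (volume.restrict (Ioc 0 y)) := by
    refine Measurable.aestronglyMeasurable ?_
    fun_prop
  refine IntegrableOn.of_bound (C := n.factorial / x ^ n * y ^ (n + γ)) measure_Ioc_lt_top hmeas ?_
  refine (ae_restrict_mem measurableSet_Ioc).mono fun w hw => ?_
  have hw0 : 0 < w := hw.1
  have h1 : Real.exp (-(x / w)) ≤ n.factorial / x ^ n * w ^ n := by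
    have h2 := Real.pow_div_factorial_le_exp (x / w) (div_pos hx hw0).le n
    rw [Real.exp_neg]
    have h3 : 0 < (x / w) ^ n / n.factorial := by positivity
    refine (inv_anti₀ h3 h2).trans (le_of_eq ?_)
    rw [div_pow]
    field_simp
  rw [Real.norm_of_nonneg (by positivity)]
  calc Real.exp (-(x / w)) * w ^ γ ≤ n.factorial / x ^ n * w ^ n * w ^ γ := by gcongr
    _ = n.factorial / x ^ n * w ^ (n + γ) := by
      rw [Real.rpow_add hw0, Real.rpow_natCast, mul_assoc]
    _ ≤ n.factorial / x ^ n * y ^ (n + γ) := by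
      gcongr
      · linarith
      · exact hw.2

lemma totallyPositive_integral_mul_sub_pow (γ : ℝ) (k : ℕ) : TotallyPositive fun x y =>
    ∫ w in Ioc 0 y, Real.exp (-(x / w)) * w ^ γ * (y - w) ^ k := by
  induction k with
  | zero =>
    simp only [pow_zero, mul_one]
    refine TotallyPositive.integral_Ioc ?_ fun x y hx _ => integrableOn_exp_neg_div_mul_rpow hx γ
    exact totallyPositive_exp_neg_div.of_eq_mul (fun _ => 1) (fun y => y ^ γ)
      (fun _ _ => zero_le_one) (fun y hy => by positivity) fun x y _ _ => by ring
  | succ k ih =>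
    refine (ih.integral_Ioc fun x y hx hy => (integral_Ioc_integral_mul_sub_pow hy
      (integrableOn_exp_neg_div_mul_rpow hx γ) k).1).of_eq_mul (fun _ => k + 1) (fun _ => 1)
      (fun _ _ => by positivity) (fun _ _ => zero_le_one) fun x y hx hy => ?_
    rw [(integral_Ioc_integral_mul_sub_pow hy (integrableOn_exp_neg_div_mul_rpow hx γ) k).2]
    have : (k : ℝ) + 1 ≠ 0 := by positivity
    field_simp

lemma image_div_sub_one_Ioo {y : ℝ} (hy : 0 < y) : (fun w => y / w - 1) '' Ioo 0 y = Ioi 0 := by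
  ext t
  simp only [mem_image, mem_Ioo, mem_Ioi]
  constructor
  · rintro ⟨w, ⟨h0, h1⟩, rfl⟩
    exact sub_pos.2 ((one_lt_div h0).2 h1)
  · intro ht
    refine ⟨y / (1 + t), ⟨by positivity, div_lt_self hy (by linarith)⟩, ?_⟩
    field_simp
    ring

lemma kernelT_nat_eq (k : ℕ) (d : ℝ) {x y : ℝ} (hy : 0 < y) :
    kernelT (k + 1) d x y = (1 / Real.Gamma (k + 1)) * (y ^ (1 - d) *
      ∫ w in Ioc 0 y, Real.exp (-(x / w)) * w ^ (d - k - 2) * (y - w) ^ k) := by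
  have hsub := integral_image_eq_integral_abs_deriv_smul (s := Ioo 0 y)
    (f := fun w => y / w - 1) (f' := fun w => -(y / w ^ 2)) measurableSet_Ioo
    (fun w hw => by
      have h := ((hasDerivAt_inv hw.1.ne').const_mul y).sub_const 1
      refine (h.congr_deriv ?_).hasDerivWithinAt
      ring)
    (fun w hw v hv h => by
      have h1 := hw.1.ne'
      have h2 := hv.1.ne'
      have h3 := hy.ne'
      simp only [sub_left_inj] at h
      field_simp at h
      exact h.symm)
    (fun t => Real.exp (-t * (x / y)) * t ^ ((k : ℝ) + 1 - 1) * (1 + t) ^ (-d))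
  rw [image_div_sub_one_Ioo hy] at hsub
  rw [kernelT, tricomiF, hsub, integral_Ioc_eq_integral_Ioo, mul_left_comm]
  congr 1
  rw [← integral_const_mul, ← integral_const_mul]
  refine setIntegral_congr_fun measurableSet_Ioo fun w hw => ?_
  have hw0 : 0 < w := hw.1
  have hexp : Real.exp (-(x / w)) = Real.exp (-(x / y)) * Real.exp (-(y / w - 1) * (x / y)) := by
    rw [← Real.exp_add]
    congr 1
    field_simp
    ring
  have hpow : (y / w - 1) ^ ((k : ℝ) + 1 - 1) = (y - w) ^ k / w ^ k := by
    rw [add_sub_cancel_right, Real.rpow_natCast, ← div_pow]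
    congr 1
    field_simp
  have hd : (1 + (y / w - 1)) ^ (-d) = y ^ (-d) * w ^ d := by
    rw [add_sub_cancel, Real.div_rpow hy.le hw0.le, Real.rpow_neg hw0.le d, div_inv_eq_mul]
  have hy1 : y ^ (1 - d) = y * y ^ (-d) := by
    rw [sub_eq_add_neg, Real.rpow_add hy, Real.rpow_one]
  have hw1 : w ^ (d - k - 2) = w ^ d / w ^ k / w ^ 2 := by
    rw [Real.rpow_sub hw0, Real.rpow_sub hw0, Real.rpow_natCast]
    norm_num
  simp only [smul_eq_mul, abs_neg]
  rw [abs_of_pos (by positivity), hexp, hpow, hd, hy1, hw1]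
  ring

lemma totallyPositive_kernelT_nat (k : ℕ) (d : ℝ) : TotallyPositive (kernelT (k + 1) d) :=
  (totallyPositive_integral_mul_sub_pow (d - k - 2) k).of_eq_mul
    (fun _ => 1 / Real.Gamma (k + 1)) (fun y => y ^ (1 - d))
    (fun _ _ => one_div_nonneg.2 (Real.Gamma_pos_of_pos (by positivity)).le)
    (fun y hy => by positivity) fun _ _ _ hy => kernelT_nat_eq k d hy

lemma kernelT_zero_right {b x y : ℝ} (hb : 0 < b) (hx : 0 < x) (hy : 0 < y) :
    kernelT b 0 x y = x ^ (-b) * (y ^ b * Real.exp (-(x / y))) := by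
  have h := Real.integral_rpow_mul_exp_neg_mul_Ioi hb (div_pos hx hy)
  have hI : ∫ t in Ioi (0 : ℝ), Real.exp (-t * (x / y)) * t ^ (b - 1) * (1 + t) ^ (-(0 : ℝ)) =
      (1 / (x / y)) ^ b * Real.Gamma b := by
    rw [← h]
    congr 1
    ext t
    rw [neg_zero, Real.rpow_zero, mul_one, mul_comm]
    ring_nf
  have hG := (Real.Gamma_pos_of_pos hb).ne'
  rw [kernelT, tricomiF, hI, one_div_div, Real.div_rpow hy.le hx.le, Real.rpow_neg hx.le]
  field_simp

/-- Kummer's transformation `Ψ(b, b+1-d, z) = z^(d-b) Ψ(d, d+1-b, z)`. -/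
lemma tricomiF_kummer {b d z : ℝ} (hb : 0 < b) (hd : 0 < d) (hz : 0 < z) :
    tricomiF b d z = z ^ (d - b) * tricomiF d b z := by
  set F : ℝ → ℝ → ℝ := fun t s =>
    Real.exp (-(t * s)) * ((t ^ (b - 1) * Real.exp (-(z * t))) * (s ^ (d - 1) * Real.exp (-(1 * s))))
    with hF
  have hint : ∀ {a r : ℝ}, 0 < a → 0 < r →
      Integrable (fun t : ℝ => t ^ (a - 1) * Real.exp (-(r * t))) (volume.restrict (Ioi 0)) := by
    intro a r ha hr
    refine Integrable.of_integral_ne_zero ?_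
    rw [Real.integral_rpow_mul_exp_neg_mul_Ioi ha hr]
    have := Real.Gamma_pos_of_pos ha
    positivity
  have hprod : Integrable (Function.uncurry F)
      ((volume.restrict (Ioi 0)).prod (volume.restrict (Ioi 0))) := by
    refine Integrable.bdd_mul (c := 1) (f := fun p : ℝ × ℝ => Real.exp (-(p.1 * p.2)))
      ((hint hb hz).mul_prod (hint hd one_pos)) (by fun_prop) ?_
    rw [Measure.prod_restrict]
    refine (ae_restrict_mem (measurableSet_Ioi.prod measurableSet_Ioi)).mono ?_
    rintro ⟨t, s⟩ ⟨ht, hs⟩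
    rw [Real.norm_of_nonneg (Real.exp_pos _).le, Real.exp_le_one_iff]
    exact neg_nonpos.2 (mul_pos ht hs).le
  have hleft : ∀ t ∈ Ioi (0 : ℝ), ∫ s in Ioi 0, F t s =
      Real.Gamma d * (Real.exp (-t * z) * t ^ (b - 1) * (1 + t) ^ (-d)) := by
    intro t ht
    have ht1 : 0 < 1 + t := by have := mem_Ioi.1 ht; linarith
    have h : ∀ s, F t s = (t ^ (b - 1) * Real.exp (-(z * t))) *
        (s ^ (d - 1) * Real.exp (-((1 + t) * s))) := by
      intro s
      rw [show -((1 + t) * s) = -(t * s) + -(1 * s) by ring, Real.exp_add]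
      simp only [hF]
      ring
    simp_rw [h]
    rw [integral_const_mul, Real.integral_rpow_mul_exp_neg_mul_Ioi hd ht1, one_div,
      Real.inv_rpow ht1.le, ← Real.rpow_neg ht1.le, show -t * z = -(z * t) by ring]
    ring
  have hright : ∀ s ∈ Ioi (0 : ℝ), ∫ t in Ioi 0, F t s =
      Real.Gamma b * (s ^ (d - 1) * Real.exp (-s) * (z + s) ^ (-b)) := by
    intro s hs
    have hs1 : 0 < z + s := by have := mem_Ioi.1 hs; linarith
    have h : ∀ t, F t s = (s ^ (d - 1) * Real.exp (-s)) *
        (t ^ (b - 1) * Real.exp (-((z + s) * t))) := by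
      intro t
      rw [show -((z + s) * t) = -(t * s) + -(z * t) by ring, Real.exp_add]
      simp only [hF, one_mul]
      ring
    simp_rw [h]
    rw [integral_const_mul, Real.integral_rpow_mul_exp_neg_mul_Ioi hb hs1, one_div,
      Real.inv_rpow hs1.le, ← Real.rpow_neg hs1.le]
    ring
  have hswap := integral_integral_swap hprod
  rw [setIntegral_congr_fun measurableSet_Ioi hleft,
    setIntegral_congr_fun measurableSet_Ioi hright, integral_const_mul, integral_const_mul] at hswap
  have hscale := integral_comp_mul_left_Ioi'
    (fun s => s ^ (d - 1) * Real.exp (-s) * (z + s) ^ (-b)) 0 hz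
  have hscaled : ∀ s ∈ Ioi (0 : ℝ), (z * s) ^ (d - 1) * Real.exp (-(z * s)) * (z + z * s) ^ (-b) =
      z ^ (d - 1 - b) * (Real.exp (-s * z) * s ^ (d - 1) * (1 + s) ^ (-b)) := by
    intro s hs
    have hs0 : 0 < s := hs
    rw [show z + z * s = z * (1 + s) by ring, Real.mul_rpow hz.le hs0.le,
      Real.mul_rpow hz.le (by positivity), sub_eq_add_neg (d - 1) b, Real.rpow_add hz (d - 1) (-b),
      show -(z * s) = -s * z by ring]
    ring
  rw [mul_zero, setIntegral_congr_fun measurableSet_Ioi hscaled, integral_const_mul, smul_eq_mul,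
    ← mul_assoc] at hscale
  have hzz : z * z ^ (d - 1 - b) = z ^ (d - b) := by
    rw [show d - b = 1 + (d - 1 - b) by ring, Real.rpow_add hz, Real.rpow_one]
  rw [hzz] at hscale
  rw [← hscale] at hswap
  have hGb := (Real.Gamma_pos_of_pos hb).ne'
  have hGd := (Real.Gamma_pos_of_pos hd).ne'
  rw [tricomiF, tricomiF]
  generalize (∫ t in Ioi (0 : ℝ), Real.exp (-t * z) * t ^ (b - 1) * (1 + t) ^ (-d)) = I at hswap ⊢
  generalize (∫ t in Ioi (0 : ℝ), Real.exp (-t * z) * t ^ (d - 1) * (1 + t) ^ (-b)) = J at hswap ⊢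
  field_simp
  linarith

lemma totallyPositive_kernelT_nat_right {b : ℝ} (hb : 0 < b) (k : ℕ) :
    TotallyPositive (kernelT b k) := by
  rcases k with _ | k
  · refine totallyPositive_exp_neg_div.of_eq_mul (fun x => x ^ (-b)) (fun y => y ^ b)
      (fun x hx => by positivity) (fun y hy => by positivity) fun x y hx hy => ?_
    simpa using kernelT_zero_right hb hx hy
  · refine (totallyPositive_kernelT_nat k b).of_eq_mul (fun x => x ^ ((k : ℝ) + 1 - b))
      (fun y => y ^ (-((k : ℝ) + 1 - b)))
      (fun x hx => by positivity) (fun y hy => by positivity) fun x y hx hy => ?_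
    push_cast
    rw [kernelT, kernelT, tricomiF_kummer hb (by positivity) (div_pos hx hy),
      Real.div_rpow hx.le hy.le, Real.rpow_neg hy.le]
    ring


/-- If `b` is a positive integer or `d` is a nonnegative integer, then `T_{b,d}` is
totally positive of every order. -/
theorem kernelT_TP_infty (b d : ℝ) (hb : 0 < b)
    (h : (∃ k : ℕ, b = k + 1) ∨ (∃ k : ℕ, d = k))
    (m : ℕ) (hm : 1 ≤ m)
    (x y : Fin m → ℝ) (hx : StrictMono x) (hy : StrictMono y)
    (hxpos : ∀ i, 0 < x i) (hypos : ∀ i, 0 < y i) :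
    0 ≤ Matrix.det (Matrix.of fun i j => kernelT b d (x i) (y j)) := by
  rcases h with ⟨k, rfl⟩ | ⟨k, rfl⟩
  · exact totallyPositive_kernelT_nat k d m x y hx hy hxpos hypos
  · exact totallyPositive_kernelT_nat_right hb k m x y hx hy hxpos hypos
end

section
/- Let b > 0 and d ∈ ℝ. If b is not a positive integer and d is not a nonnegative integer, then the kernel T_{b,d} is not totally positive of order infinity: there exist an integer m ≥ 1 and reals 0 < x₁ < … < x_m and 0 < y₁ < … < y_m such that det[T_{b,d}(x_i, y_j)]_{1≤i,j≤m} < 0. -/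
open Filter Topology Matrix MeasureTheory Set
open scoped fwdDiff ContDiff

/-- Nonnegativity of all determinants formed from the successive derivatives of `κ` at decreasing
points: the confluent form of total positivity of the kernel `(u, v) ↦ κ (u - v)`. -/
def HasNonnegDerivDets (κ : ℝ → ℝ) : Prop :=
  ∀ (m : ℕ) (c : Fin m → ℝ), StrictAnti c →
    0 ≤ (Matrix.of fun i j : Fin m => iteratedDeriv (j : ℕ) κ (c i)).det

theorem exists_iterate_fwdDiff_eq_iteratedDeriv {ε : ℝ} (hε : 0 < ε) (n : ℕ) :
    ∀ {κ : ℝ → ℝ}, ContDiff ℝ ∞ κ → ∀ x : ℝ,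
      ∃ ξ ∈ Set.Icc x (x + n * ε), (Δ_[ε])^[n] κ x = ε ^ n * iteratedDeriv n κ ξ := by
  induction n with
  | zero => intro κ _ x; exact ⟨x, by simp, by simp⟩
  | succ n ih =>
    intro κ hκ x
    have hs : ContDiff ℝ ∞ (fun y => κ (y + ε)) := hκ.comp (contDiff_id.add contDiff_const)
    have hΔ : ContDiff ℝ ∞ (Δ_[ε] κ) := hs.sub hκ
    obtain ⟨ξ, hξ, h⟩ := ih hΔ x
    have hd : iteratedDeriv n (Δ_[ε] κ) ξ = iteratedDeriv n κ (ξ + ε) - iteratedDeriv n κ ξ := by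
      have : Δ_[ε] κ = (fun y => κ (y + ε)) - κ := rfl
      rw [this, iteratedDeriv_sub (hs.of_le (by exact_mod_cast le_top)).contDiffAt
        (hκ.of_le (by exact_mod_cast le_top)).contDiffAt, iteratedDeriv_comp_add_const]
    have hdiff : Differentiable ℝ (iteratedDeriv n κ) :=
      hκ.differentiable_iteratedDeriv n (by exact_mod_cast WithTop.coe_lt_top _)
    obtain ⟨η, hη, h'⟩ := exists_deriv_eq_slope (iteratedDeriv n κ) (show ξ < ξ + ε by linarith)
      hdiff.continuous.continuousOn hdiff.differentiableOn
    refine ⟨η, ⟨by linarith [hξ.1, hη.1], ?_⟩, ?_⟩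
    · push_cast
      linarith [hξ.2, hη.2]
    · rw [Function.iterate_succ_apply, h, hd, iteratedDeriv_succ, h', add_sub_cancel_left,
        pow_succ, mul_assoc, mul_div_cancel₀ _ hε.ne']

theorem tendsto_iterate_fwdDiff_div_pow {κ : ℝ → ℝ} (hκ : ContDiff ℝ ∞ κ) (n : ℕ) (x : ℝ) :
    Tendsto (fun ε : ℝ => (ε ^ n)⁻¹ * (Δ_[ε])^[n] κ x) (𝓝[>] 0) (𝓝 (iteratedDeriv n κ x)) := by
  have hc : Continuous (iteratedDeriv n κ) :=
    hκ.continuous_iteratedDeriv n (by exact_mod_cast le_top)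
  rw [Metric.tendsto_nhds]
  intro δ hδ
  obtain ⟨r, hr, hball⟩ := Metric.continuousAt_iff.1 (hc.continuousAt (x := x)) δ hδ
  have h0 : Tendsto (fun ε : ℝ => (n : ℝ) * ε) (𝓝[>] 0) (𝓝 0) := by
    have : Tendsto (fun ε : ℝ => (n : ℝ) * ε) (𝓝 0) (𝓝 (n * 0)) := by
      exact (continuous_const.mul continuous_id).tendsto 0
    rw [mul_zero] at this
    exact this.mono_left nhdsWithin_le_nhds
  filter_upwards [h0.eventually (gt_mem_nhds hr), self_mem_nhdsWithin] with ε hεr hε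
  obtain ⟨ξ, hξ, h⟩ := exists_iterate_fwdDiff_eq_iteratedDeriv (Set.mem_Ioi.1 hε) n hκ x
  rw [h, inv_mul_cancel_left₀ (pow_ne_zero _ (Set.mem_Ioi.1 hε).ne')]
  apply hball
  rw [Real.dist_eq, abs_lt]
  constructor <;> linarith [hξ.1, hξ.2]

theorem det_iterate_fwdDiff (κ : ℝ → ℝ) (ε : ℝ) {m : ℕ} (c : Fin m → ℝ) :
    (Matrix.of fun i j : Fin m => (Δ_[ε])^[(j : ℕ)] κ (c i)).det =
      (Matrix.of fun i j : Fin m => κ (c i + (j : ℕ) * ε)).det := by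
  set U : Matrix (Fin m) (Fin m) ℝ :=
    Matrix.of fun k j => (-1) ^ ((j : ℕ) - k) * ((j : ℕ).choose k : ℝ) with hU
  have hdet : U.det = 1 := by
    rw [Matrix.det_of_isUpperTriangular]
    · simp [hU]
    · intro i j hij
      simp [hU, Nat.choose_eq_zero_of_lt (show (j : ℕ) < i from hij)]
  have hmul : (Matrix.of fun i j : Fin m => (Δ_[ε])^[(j : ℕ)] κ (c i)) =
      (Matrix.of fun i j : Fin m => κ (c i + (j : ℕ) * ε)) * U := by
    ext i j
    rw [Matrix.mul_apply, Matrix.of_apply, fwdDiff_iter_eq_sum_shift]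
    change _ = ∑ k : Fin m,
      κ (c i + (k : ℕ) * ε) * ((-1) ^ ((j : ℕ) - k) * ((j : ℕ).choose k : ℝ))
    rw [Fin.sum_univ_eq_sum_range
      (fun k => κ (c i + (k : ℕ) * ε) * ((-1) ^ ((j : ℕ) - k) * ((j : ℕ).choose k : ℝ))) m]
    rw [← Finset.sum_subset (Finset.range_subset_range.2 (show (j : ℕ) + 1 ≤ m from j.2))]
    · refine Finset.sum_congr rfl fun k _ => ?_
      simp [mul_comm]
    · intro k _ hk
      rw [Finset.mem_range, not_lt] at hk
      simp [Nat.choose_eq_zero_of_lt (show (j : ℕ) < k from hk)]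
  rw [hmul, Matrix.det_mul, hdet, mul_one]

theorem HasNonnegDerivDets.of_det_nonneg {κ : ℝ → ℝ} (hκ : ContDiff ℝ ∞ κ)
    (h : ∀ (m : ℕ) (c e : Fin m → ℝ), StrictAnti c → StrictMono e →
      0 ≤ (Matrix.of fun i j => κ (c i + e j)).det) : HasNonnegDerivDets κ := by
  intro m c hc
  have hlim : Tendsto (fun ε : ℝ => (Matrix.of fun i j : Fin m =>
      (ε ^ (j : ℕ))⁻¹ * (Δ_[ε])^[(j : ℕ)] κ (c i)).det) (𝓝[>] 0)
      (𝓝 (Matrix.of fun i j : Fin m => iteratedDeriv (j : ℕ) κ (c i)).det) := by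
    refine (Continuous.matrix_det continuous_id).continuousAt.tendsto.comp ?_
    refine tendsto_pi_nhds.2 fun i => tendsto_pi_nhds.2 fun j => ?_
    exact tendsto_iterate_fwdDiff_div_pow hκ _ _
  refine ge_of_tendsto hlim ?_
  filter_upwards [self_mem_nhdsWithin] with ε hε
  have hε : 0 < ε := hε
  have := Matrix.det_mul_row (fun j : Fin m => (ε ^ (j : ℕ))⁻¹)
    (Matrix.of fun i j : Fin m => (Δ_[ε])^[(j : ℕ)] κ (c i))
  simp only [Matrix.of_apply] at this
  rw [this, det_iterate_fwdDiff]
  refine mul_nonneg (Finset.prod_nonneg fun j _ => by positivity) (h m c _ hc ?_)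
  intro i j hij
  have : ((i : ℕ) : ℝ) < (j : ℕ) := by exact_mod_cast hij
  exact mul_lt_mul_of_pos_right this hε

theorem HasNonnegDerivDets.const_mul {κ : ℝ → ℝ} (h : HasNonnegDerivDets κ) {C : ℝ}
    (hC : 0 ≤ C) : HasNonnegDerivDets fun u => C * κ u := by
  intro m c hc
  have : (Matrix.of fun i j : Fin m => iteratedDeriv (j : ℕ) (fun u => C * κ u) (c i)) =
      C • (Matrix.of fun i j : Fin m => iteratedDeriv (j : ℕ) κ (c i)) := by
    ext i j
    simp [iteratedDeriv_const_mul_field]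
  rw [this, Matrix.det_smul]
  exact mul_nonneg (by positivity) (h m c hc)

theorem HasNonnegDerivDets.nonneg {κ : ℝ → ℝ} (h : HasNonnegDerivDets κ) (u : ℝ) : 0 ≤ κ u := by
  simpa using h 1 (fun _ => u) (Subsingleton.strictAnti _)

/-- If `κ` behaves like `exp (σ u)` at `+∞`, then `κ' - σ κ` inherits the nonnegativity of the
derivative determinants from `κ`. -/
theorem HasNonnegDerivDets.deriv_sub_mul {κ : ℝ → ℝ} (h : HasNonnegDerivDets κ)
    (hκ : ContDiff ℝ ∞ κ) {σ : ℝ} (hpos : ∀ᶠ u in atTop, 0 < κ u)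
    (hlim : ∀ n : ℕ, Tendsto (fun u => iteratedDeriv n κ u / κ u) atTop (𝓝 (σ ^ n))) :
    HasNonnegDerivDets fun u => deriv κ u - σ * κ u := by
  intro m c hc
  have hd : ∀ (n : ℕ) (u : ℝ), iteratedDeriv n (fun u => deriv κ u - σ * κ u) u =
      iteratedDeriv (n + 1) κ u - σ * iteratedDeriv n κ u := by
    intro n u
    have h1 : ContDiff ℝ n (deriv κ) := by
      have : ContDiff ℝ (n + 1 : ℕ) κ := hκ.of_le (by exact_mod_cast le_top)
      exact this.deriv'
    have h2 : ContDiff ℝ n (fun u => σ * κ u) :=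
      contDiff_const.mul (hκ.of_le (by exact_mod_cast le_top))
    have : (fun u => deriv κ u - σ * κ u) = deriv κ - fun u => σ * κ u := rfl
    rw [this, iteratedDeriv_sub h1.contDiffAt h2.contDiffAt, iteratedDeriv_const_mul_field,
      iteratedDeriv_succ']
  let A : ℝ → Matrix (Fin (m + 1)) (Fin (m + 1)) ℝ := fun u =>
    Matrix.of fun i j => iteratedDeriv (j : ℕ) κ ((Fin.cons u c : Fin (m + 1) → ℝ) i)
  let L : Fin (m + 1) → ℝ → ℝ := fun j u => iteratedDeriv (j : ℕ) κ u / κ u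
  let B : ℝ → Matrix (Fin (m + 1)) (Fin (m + 1)) ℝ := fun u =>
    Matrix.of (Fin.cons (fun j => L j u) fun i j => iteratedDeriv (j : ℕ) κ (c i))
  let B' : Matrix (Fin (m + 1)) (Fin (m + 1)) ℝ :=
    Matrix.of (Fin.cons (fun j => σ ^ (j : ℕ)) fun i j => iteratedDeriv (j : ℕ) κ (c i))
  have hB : Tendsto (fun u => (B u).det) atTop (𝓝 B'.det) := by
    refine (Continuous.matrix_det continuous_id).continuousAt.tendsto.comp ?_
    refine tendsto_pi_nhds.2 fun i => tendsto_pi_nhds.2 fun j => ?_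
    refine Fin.cases ?_ (fun i => ?_) i
    · exact hlim j
    · exact tendsto_const_nhds
  have hB' : B'.det = (Matrix.of fun i j : Fin m =>
      iteratedDeriv (j : ℕ) (fun u => deriv κ u - σ * κ u) (c i)).det := by
    let E : Matrix (Fin (m + 1)) (Fin (m + 1)) ℝ := Matrix.of fun i =>
      Fin.cons (B' i 0) fun j => B' i j.succ - σ * B' i j.castSucc
    have hE : B'.det = E.det := by
      refine Matrix.det_eq_of_forall_col_eq_smul_add_pred (fun _ => σ) (fun i => ?_) fun i j => ?_
      · simp [E]
      · simp [E]
    rw [hE, Matrix.det_succ_row_zero, Fin.sum_univ_succ, Finset.sum_eq_zero]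
    · simp only [Fin.val_zero, pow_zero, one_mul, add_zero]
      have : E 0 0 = 1 := by simp [E, B']
      rw [this, one_mul]
      congr 1
      ext i j
      simp [E, B', hd]
    · intro j _
      have : E 0 j.succ = 0 := by simp [E, B', pow_succ, mul_comm]
      rw [this]
      simp
  rw [← hB']
  refine ge_of_tendsto hB ?_
  have hbd : ∀ᶠ u in atTop, ∀ i, c i < u :=
    Filter.eventually_all.2 fun i => eventually_gt_atTop (c i)
  filter_upwards [hpos, hbd] with u hu hcu
  have hA : 0 ≤ (A u).det := by
    refine h (m + 1) (Fin.cons u c) ?_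
    intro i j hij
    induction j using Fin.cases with
    | zero => exact absurd hij (Fin.not_lt_zero _)
    | succ j =>
      induction i using Fin.cases with
      | zero => simpa using hcu j
      | succ i => simpa using hc (Fin.succ_lt_succ_iff.1 hij)
  have hAB : (B u).det = (κ u)⁻¹ * (A u).det := by
    have : B u = Matrix.of fun i j =>
        (Fin.cons (κ u)⁻¹ (fun _ => 1) : Fin (m + 1) → ℝ) i * A u i j := by
      ext i j
      induction i using Fin.cases with
      | zero => simp [B, A, L, div_eq_inv_mul]
      | succ i => simp [B, A]
    rw [this, Matrix.det_mul_column]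
    simp [Fin.prod_univ_succ]
  rw [hAB]
  exact mul_nonneg (inv_nonneg.2 hu.le) hA

/-- The integral `∫₀^∞ e^{-(1+t)z} t^{b-1} (1+t)^{-d} dt`, that is, `Γ(b) e^{-z} Ψ(b, b+1-d, z)`. -/
noncomputable def tricomiIntegral (b d z : ℝ) : ℝ :=
  ∫ t in Ioi (0 : ℝ), Real.exp (-((1 + t) * z)) * t ^ (b - 1) * (1 + t) ^ (-d)

theorem exists_rpow_le_mul_exp (p : ℝ) {δ : ℝ} (hδ : 0 < δ) :
    ∃ C : ℝ, 0 ≤ C ∧ ∀ s : ℝ, 1 ≤ s → s ^ p ≤ C * Real.exp (s * δ) := by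
  obtain ⟨n, hn⟩ := exists_nat_ge p
  refine ⟨n.factorial / δ ^ n, by positivity, fun s hs => ?_⟩
  have h1 : s ^ p ≤ s ^ n := by
    rw [← Real.rpow_natCast]
    exact Real.rpow_le_rpow_of_exponent_le hs hn
  have h2 := Real.pow_div_factorial_le_exp (s * δ) (by positivity) n
  rw [mul_pow] at h2
  refine h1.trans ?_
  rw [div_le_iff₀ (by positivity)] at h2
  rw [div_mul_eq_mul_div, le_div_iff₀ (by positivity)]
  linarith

theorem integrableOn_tricomiIntegrand {b z : ℝ} (hb : 0 < b) (hz : 0 < z) (d : ℝ) :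
    IntegrableOn (fun t : ℝ => Real.exp (-((1 + t) * z)) * t ^ (b - 1) * (1 + t) ^ (-d))
      (Ioi 0) := by
  obtain ⟨C, hC, h⟩ := exists_rpow_le_mul_exp (-d) (half_pos hz)
  have hint := (integrableOn_rpow_mul_exp_neg_mul_rpow (s := b - 1) (by linarith) one_pos
    (half_pos hz)).const_mul C
  refine Integrable.mono' hint (Measurable.aestronglyMeasurable (by fun_prop)) ?_
  filter_upwards [ae_restrict_mem measurableSet_Ioi] with t ht
  have ht : 0 < t := ht
  rw [Real.norm_of_nonneg (by positivity), Real.rpow_one]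
  have h1 := h (1 + t) (by linarith)
  calc _ ≤ Real.exp (-((1 + t) * z)) * t ^ (b - 1) * (C * Real.exp ((1 + t) * (z / 2))) := by
        gcongr
    _ = C * (t ^ (b - 1) * Real.exp (-((1 + t) * z) + (1 + t) * (z / 2))) := by
        rw [Real.exp_add]; ring
    _ ≤ _ := by
        gcongr
        nlinarith

theorem tricomiIntegral_pos {b z : ℝ} (hb : 0 < b) (hz : 0 < z) (d : ℝ) :
    0 < tricomiIntegral b d z := by
  refine (integral_pos_iff_support_of_nonneg_ae ?_ (integrableOn_tricomiIntegrand hb hz d)).2 ?_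
  · filter_upwards [ae_restrict_mem measurableSet_Ioi] with t ht
    have ht : 0 < t := ht
    simp only [Pi.zero_apply]
    positivity
  · refine lt_of_lt_of_le (b := volume.restrict (Ioi (0 : ℝ)) (Ioi 0)) (by simp) (measure_mono ?_)
    intro t ht
    have ht : 0 < t := ht
    have : 0 < Real.exp (-((1 + t) * z)) * t ^ (b - 1) * (1 + t) ^ (-d) := by positivity
    exact this.ne'

theorem tricomiIntegral_le_of_le {b z w d d' : ℝ} (hb : 0 < b) (hz : 0 < z) (hzw : z ≤ w)
    (hd : d' ≤ d) : tricomiIntegral b d w ≤ tricomiIntegral b d' z := by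
  refine setIntegral_mono_on (integrableOn_tricomiIntegrand hb (hz.trans_le hzw) d)
    (integrableOn_tricomiIntegrand hb hz d') measurableSet_Ioi fun t ht => ?_
  have ht : 0 < t := ht
  have : (1 : ℝ) ≤ 1 + t := by linarith
  gcongr

theorem hasDerivAt_tricomiIntegral {b z : ℝ} (hb : 0 < b) (hz : 0 < z) (d : ℝ) :
    HasDerivAt (tricomiIntegral b d) (-tricomiIntegral b (d - 1) z) z := by
  have key := hasDerivAt_integral_of_dominated_loc_of_deriv_le
    (μ := volume.restrict (Ioi (0 : ℝ))) (x₀ := z) (s := Ioi (z / 2))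
    (F := fun z t => Real.exp (-((1 + t) * z)) * t ^ (b - 1) * (1 + t) ^ (-d))
    (F' := fun z t => -(Real.exp (-((1 + t) * z)) * t ^ (b - 1) * (1 + t) ^ (-(d - 1))))
    (bound := fun t => Real.exp (-((1 + t) * (z / 2))) * t ^ (b - 1) * (1 + t) ^ (-(d - 1)))
    (Ioi_mem_nhds (by linarith))
    (Eventually.of_forall fun _ => Measurable.aestronglyMeasurable (by fun_prop))
    (integrableOn_tricomiIntegrand hb hz d)
    (Measurable.aestronglyMeasurable (by fun_prop)) ?_
    (integrableOn_tricomiIntegrand hb (half_pos hz) (d - 1)) ?_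
  · have := key.2
    rwa [integral_neg] at this
  · filter_upwards [ae_restrict_mem measurableSet_Ioi] with t ht x hx
    have ht : 0 < t := ht
    have hx : z / 2 < x := hx
    rw [norm_neg, Real.norm_of_nonneg (by positivity)]
    gcongr
  · filter_upwards [ae_restrict_mem measurableSet_Ioi] with t ht x hx
    have ht : 0 < t := ht
    have h1 : HasDerivAt (fun x : ℝ => -((1 + t) * x)) (-(1 + t)) x :=
      ((hasDerivAt_id x).const_mul (1 + t)).fun_neg.congr_deriv (by simp)
    have h2 := (h1.exp.mul_const (t ^ (b - 1))).mul_const ((1 + t) ^ (-d))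
    refine h2.congr_deriv ?_
    rw [show -(d - 1) = -d + 1 by ring, Real.rpow_add_one (by positivity)]
    ring

theorem tricomiIntegral_add_one {b z : ℝ} (hb : 0 < b) (hz : 0 < z) (d : ℝ) :
    tricomiIntegral (b + 1) d z = tricomiIntegral b (d - 1) z - tricomiIntegral b d z := by
  rw [tricomiIntegral, tricomiIntegral, tricomiIntegral,
    ← integral_sub (integrableOn_tricomiIntegrand hb hz _) (integrableOn_tricomiIntegrand hb hz _)]
  refine setIntegral_congr_fun measurableSet_Ioi fun t ht => ?_
  have ht : 0 < t := ht
  rw [show -(d - 1) = -d + 1 by ring, Real.rpow_add_one (by positivity),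
    show b + 1 - 1 = b - 1 + 1 by ring, Real.rpow_add_one ht.ne']
  ring

theorem mul_tricomiIntegral_add_one_add {b z : ℝ} (hb : 0 < b) (hz : 0 < z) (d : ℝ) :
    z * tricomiIntegral (b + 1) d z + d * tricomiIntegral (b + 1) (d + 1) z =
      b * tricomiIntegral b d z := by
  have hb' : 0 < b + 1 := by linarith
  have i1 := (integrableOn_tricomiIntegrand hb' hz d).const_mul z
  have i2 := (integrableOn_tricomiIntegrand hb' hz (d + 1)).const_mul d
  have i12 : IntegrableOn (fun t : ℝ =>
      z * (Real.exp (-((1 + t) * z)) * t ^ (b + 1 - 1) * (1 + t) ^ (-d)) +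
      d * (Real.exp (-((1 + t) * z)) * t ^ (b + 1 - 1) * (1 + t) ^ (-(d + 1)))) (Ioi 0) :=
    i1.add i2
  have i3 := (integrableOn_tricomiIntegrand hb hz d).const_mul b
  have hderiv : ∀ t ∈ Ioi (0 : ℝ), HasDerivAt
      (fun t : ℝ => Real.exp (-((1 + t) * z)) * t ^ (b + 1 - 1) * (1 + t) ^ (-d))
      (b * (Real.exp (-((1 + t) * z)) * t ^ (b - 1) * (1 + t) ^ (-d)) -
        (z * (Real.exp (-((1 + t) * z)) * t ^ (b + 1 - 1) * (1 + t) ^ (-d)) +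
        d * (Real.exp (-((1 + t) * z)) * t ^ (b + 1 - 1) * (1 + t) ^ (-(d + 1))))) t := by
    intro t ht
    have ht : 0 < t := ht
    have h1 : HasDerivAt (fun t : ℝ => -((1 + t) * z)) (-z) t :=
      (((hasDerivAt_id t).const_add 1).mul_const z).fun_neg.congr_deriv (by simp)
    have h2 : HasDerivAt (fun t : ℝ => t ^ (b + 1 - 1)) ((b + 1 - 1) * t ^ (b + 1 - 1 - 1)) t :=
      Real.hasDerivAt_rpow_const (Or.inl ht.ne')
    have h3 : HasDerivAt (fun t : ℝ => (1 + t) ^ (-d)) (1 * (-d) * (1 + t) ^ (-d - 1)) t :=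
      ((hasDerivAt_id t).const_add 1).rpow_const (Or.inl (by simp only [id]; positivity))
    refine ((h1.exp.fun_mul h2).fun_mul h3).congr_deriv ?_
    rw [show -(d + 1) = -d - 1 by ring, show b + 1 - 1 = b by ring]
    ring
  have hzero := tendsto_zero_of_hasDerivAt_of_integrableOn_Ioi hderiv (i3.sub i12)
    (integrableOn_tricomiIntegrand hb' hz d)
  have hcont : ContinuousWithinAt
      (fun t : ℝ => Real.exp (-((1 + t) * z)) * t ^ (b + 1 - 1) * (1 + t) ^ (-d)) (Ici 0) 0 := by
    have h2 : ContinuousAt (fun t : ℝ => t ^ (b + 1 - 1)) 0 :=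
      Real.continuousAt_rpow_const _ _ (Or.inr (by linarith))
    have h3 : ContinuousAt (fun t : ℝ => (1 + t) ^ (-d)) 0 :=
      ContinuousAt.rpow_const (by fun_prop) (Or.inl (by simp))
    have h1 : ContinuousAt (fun t : ℝ => Real.exp (-((1 + t) * z))) 0 := by fun_prop
    exact ((h1.mul h2).mul h3).continuousWithinAt
  have := integral_Ioi_of_hasDerivAt_of_tendsto hcont hderiv (i3.sub i12) hzero
  rw [integral_sub i3 i12, integral_add i1 i2, integral_const_mul, integral_const_mul,
    integral_const_mul, show b + 1 - 1 = b by ring, Real.zero_rpow hb.ne'] at this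
  simp only [tricomiIntegral, show b + 1 - 1 = b by ring]
  linarith

theorem mul_tricomiIntegral_sub_one {b z : ℝ} (hb : 0 < b) (hz : 0 < z) (d : ℝ) :
    z * tricomiIntegral b (d - 1) z - (b - d) * tricomiIntegral b d z =
      z * tricomiIntegral b d z + d * tricomiIntegral b (d + 1) z := by
  have h := mul_tricomiIntegral_add_one_add hb hz d
  rw [tricomiIntegral_add_one hb hz, tricomiIntegral_add_one hb hz, add_sub_cancel_right] at h
  linarith

theorem integrableOn_rpow_mul_one_add_rpow {b d : ℝ} (hb : 0 < b) (hd : b < d) :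
    IntegrableOn (fun t : ℝ => t ^ (b - 1) * (1 + t) ^ (-d)) (Ioi 0) := by
  rw [← Ioc_union_Ioi_eq_Ioi (zero_le_one (α := ℝ)), integrableOn_union]
  constructor
  · have h : IntegrableOn (fun t : ℝ => t ^ (b - 1)) (Ioc 0 1) :=
      (intervalIntegrable_iff_integrableOn_Ioc_of_le zero_le_one).1
        (intervalIntegral.intervalIntegrable_rpow' (by linarith))
    refine Integrable.mono' h (Measurable.aestronglyMeasurable (by fun_prop)) ?_
    filter_upwards [ae_restrict_mem measurableSet_Ioc] with t ht
    have ht0 : 0 < t := ht.1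
    rw [Real.norm_of_nonneg (by positivity)]
    exact mul_le_of_le_one_right (by positivity)
      (Real.rpow_le_one_of_one_le_of_nonpos (by linarith) (by linarith))
  · have h : IntegrableOn (fun t : ℝ => t ^ (b - 1 - d)) (Ioi 1) :=
      integrableOn_Ioi_rpow_of_lt (by linarith) one_pos
    refine Integrable.mono' h (Measurable.aestronglyMeasurable (by fun_prop)) ?_
    filter_upwards [ae_restrict_mem measurableSet_Ioi] with t ht
    have ht0 : 0 < t := one_pos.trans ht
    rw [Real.norm_of_nonneg (by positivity), sub_eq_add_neg _ d, Real.rpow_add ht0]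
    gcongr ?_ * ?_
    exact Real.rpow_le_rpow_of_nonpos ht0 (by linarith) (by linarith)

theorem exists_tricomiIntegral_le {b d : ℝ} (hb : 0 < b) (hd : b < d) :
    ∃ C : ℝ, ∀ z, 0 < z → tricomiIntegral b d z ≤ C := by
  refine ⟨∫ t in Ioi (0 : ℝ), t ^ (b - 1) * (1 + t) ^ (-d), fun z hz => ?_⟩
  refine setIntegral_mono_on (integrableOn_tricomiIntegrand hb hz d)
    (integrableOn_rpow_mul_one_add_rpow hb hd) measurableSet_Ioi fun t ht => ?_
  have ht : 0 < t := ht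
  rw [mul_assoc]
  refine mul_le_of_le_one_left (by positivity) (Real.exp_le_one_iff.2 ?_)
  have : 0 < (1 + t) * z := by positivity
  linarith

theorem tendsto_mul_tricomiIntegral_sub_one {b d : ℝ} (hb : 0 < b) (hd : b < d) :
    Tendsto (fun z => z * tricomiIntegral b (d - 1) z) (𝓝[>] 0) (𝓝 0) := by
  have key : Tendsto (fun z : ℝ => ∫ t in Ioi (0 : ℝ),
      z * (Real.exp (-((1 + t) * z)) * t ^ (b - 1) * (1 + t) ^ (-(d - 1)))) (𝓝[>] 0)
      (𝓝 (∫ _ in Ioi (0 : ℝ), (0 : ℝ))) := by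
    refine tendsto_integral_filter_of_dominated_convergence
      (fun t => t ^ (b - 1) * (1 + t) ^ (-d))
      (Eventually.of_forall fun _ => Measurable.aestronglyMeasurable (by fun_prop)) ?_
      (integrableOn_rpow_mul_one_add_rpow hb hd) ?_
    · filter_upwards [self_mem_nhdsWithin] with z hz
      filter_upwards [ae_restrict_mem measurableSet_Ioi] with t ht
      have ht : 0 < t := ht
      have hz : 0 < z := hz
      rw [Real.norm_of_nonneg (by positivity), show -(d - 1) = -d + 1 by ring,
        Real.rpow_add_one (by positivity)]
      have h1 : (1 + t) * z * Real.exp (-((1 + t) * z)) ≤ 1 := by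
        rw [Real.exp_neg, ← div_eq_mul_inv, div_le_one (Real.exp_pos _)]
        linarith [Real.add_one_le_exp ((1 + t) * z)]
      calc _ = ((1 + t) * z * Real.exp (-((1 + t) * z))) * (t ^ (b - 1) * (1 + t) ^ (-d)) := by ring
        _ ≤ _ := mul_le_of_le_one_left (by positivity) h1
    · refine Eventually.of_forall fun t => ?_
      have : Continuous fun z : ℝ =>
          z * (Real.exp (-((1 + t) * z)) * t ^ (b - 1) * (1 + t) ^ (-(d - 1))) := by fun_prop
      simpa using (this.tendsto 0).mono_left nhdsWithin_le_nhds
  simpa [tricomiIntegral, integral_const_mul] using key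

theorem tendsto_tricomiIntegral_atTop {b d : ℝ} (hb : 0 < b) (hd : d ≤ b) :
    Tendsto (tricomiIntegral b d) (𝓝[>] 0) atTop := by
  set c := b * tricomiIntegral b (b + 1) 1 with hc
  have hcpos : 0 < c := mul_pos hb (tricomiIntegral_pos hb one_pos _)
  have hder : ∀ z : ℝ, 0 < z → HasDerivAt (fun z => tricomiIntegral b b z + c * Real.log z)
      (-tricomiIntegral b (b - 1) z + c * z⁻¹) z := fun z hz =>
    (hasDerivAt_tricomiIntegral hb hz b).add ((Real.hasDerivAt_log hz.ne').const_mul c)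
  have hanti : AntitoneOn (fun z => tricomiIntegral b b z + c * Real.log z) (Ioc 0 1) := by
    refine antitoneOn_of_deriv_nonpos (convex_Ioc 0 1)
      (fun z hz => (hder z hz.1).continuousAt.continuousWithinAt) ?_ ?_
    · rw [interior_Ioc]
      exact fun z hz => (hder z hz.1).differentiableAt.differentiableWithinAt
    · rw [interior_Ioc]
      intro z hz
      rw [(hder z hz.1).deriv]
      have h1 := mul_tricomiIntegral_sub_one hb hz.1 b
      have h2 : tricomiIntegral b (b + 1) 1 ≤ tricomiIntegral b (b + 1) z :=
        tricomiIntegral_le_of_le hb hz.1 hz.2.le le_rfl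
      have h3 := mul_pos hz.1 (tricomiIntegral_pos hb hz.1 b)
      have h4 : c ≤ z * tricomiIntegral b (b - 1) z := by
        have := mul_le_mul_of_nonneg_left h2 hb.le
        linarith
      have h5 : c * z⁻¹ ≤ tricomiIntegral b (b - 1) z := by
        rw [← div_eq_mul_inv, div_le_iff₀ hz.1]
        linarith
      linarith
  have hlog : Tendsto (fun z => -(c * Real.log z)) (𝓝[>] 0) atTop :=
    tendsto_neg_atBot_atTop.comp (Real.tendsto_log_nhdsGT_zero.const_mul_atBot hcpos)
  refine tendsto_atTop_mono' _ ?_ hlog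
  filter_upwards [Ioc_mem_nhdsGT (zero_lt_one (α := ℝ))] with z hz
  have h1 := hanti hz ⟨one_pos, le_rfl⟩ hz.2
  simp only [Real.log_one, mul_zero, add_zero] at h1
  have h2 := tricomiIntegral_pos hb one_pos b
  have h3 : tricomiIntegral b b z ≤ tricomiIntegral b d z :=
    tricomiIntegral_le_of_le hb hz.1 le_rfl hd
  linarith

theorem tendsto_tricomiIntegral_add_one_div {b d : ℝ} (hb : 0 < b) (hd : d ≤ b) :
    Tendsto (fun z => tricomiIntegral b (d + 1) z / tricomiIntegral b d z) (𝓝[>] 0) (𝓝 0) := by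
  obtain ⟨K, hK⟩ := exists_nat_gt (b - d)
  obtain ⟨C, hC⟩ := exists_tricomiIntegral_le hb (show b < d + (K + 1 : ℕ) by push_cast; linarith)
  have hle : ∀ δ z : ℝ, 0 < δ → 0 < z → tricomiIntegral b (d + 1) z ≤
      δ * tricomiIntegral b d z + (δ ^ K)⁻¹ * tricomiIntegral b (d + (K + 1 : ℕ)) z := by
    intro δ z hδ hz
    rw [tricomiIntegral, tricomiIntegral, tricomiIntegral, ← integral_const_mul,
      ← integral_const_mul, ← integral_add ((integrableOn_tricomiIntegrand hb hz _).const_mul _)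
      ((integrableOn_tricomiIntegrand hb hz _).const_mul _)]
    refine setIntegral_mono_on (integrableOn_tricomiIntegrand hb hz _)
      (((integrableOn_tricomiIntegrand hb hz _).const_mul _).add
      ((integrableOn_tricomiIntegrand hb hz _).const_mul _)) measurableSet_Ioi fun t ht => ?_
    have ht : 0 < t := ht
    have hs : 0 < 1 + t := by linarith
    have hinv : (1 + t)⁻¹ ≤ δ + (δ ^ K)⁻¹ * ((1 + t) ^ (K + 1))⁻¹ := by
      rcases le_total (1 + t)⁻¹ δ with h | h
      · exact h.trans (le_add_of_nonneg_right (by positivity))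
      · have : 1 ≤ (δ ^ K)⁻¹ * ((1 + t) ^ K)⁻¹ := by
          rw [← mul_inv, ← mul_pow]
          refine (one_le_inv₀ (by positivity)).2 (pow_le_one₀ (by positivity) ?_)
          calc δ * (1 + t) ≤ (1 + t)⁻¹ * (1 + t) := by gcongr
            _ = 1 := inv_mul_cancel₀ hs.ne'
        have h2 := mul_le_mul_of_nonneg_right this (inv_nonneg.2 hs.le)
        rw [pow_succ, mul_inv]
        linarith
    have e1 : (1 + t) ^ (-(d + 1)) = (1 + t) ^ (-d) * (1 + t)⁻¹ := by
      rw [neg_add, Real.rpow_add hs, Real.rpow_neg_one]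
    have e2 : (1 + t) ^ (-(d + (K + 1 : ℕ))) = (1 + t) ^ (-d) * ((1 + t) ^ (K + 1))⁻¹ := by
      rw [neg_add, Real.rpow_add hs, Real.rpow_neg hs.le, Real.rpow_neg hs.le, Real.rpow_natCast]
    rw [e1, e2]
    have h3 := mul_le_mul_of_nonneg_left hinv
      (show 0 ≤ Real.exp (-((1 + t) * z)) * t ^ (b - 1) * (1 + t) ^ (-d) by positivity)
    linarith
  rw [Metric.tendsto_nhds]
  intro δ hδ
  have hlarge := (tendsto_tricomiIntegral_atTop hb hd).eventually_gt_atTop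
    (((δ / 2) ^ K)⁻¹ * C / (δ / 2))
  filter_upwards [hlarge, self_mem_nhdsWithin] with z hz1 hz
  have hz : 0 < z := hz
  have hI := tricomiIntegral_pos hb hz d
  rw [Real.dist_eq, sub_zero, abs_of_pos (div_pos (tricomiIntegral_pos hb hz _) hI), div_lt_iff₀ hI]
  rw [div_lt_iff₀ (by positivity)] at hz1
  have h1 := hle (δ / 2) z (by positivity) hz
  have h2 := mul_le_mul_of_nonneg_left (hC z hz) (show 0 ≤ ((δ / 2) ^ K)⁻¹ by positivity)
  linarith

theorem tendsto_mul_tricomiIntegral_sub_one_div {b : ℝ} (hb : 0 < b) (d : ℝ) :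
    Tendsto (fun z => z * tricomiIntegral b (d - 1) z / tricomiIntegral b d z) (𝓝[>] 0)
      (𝓝 (max (b - d) 0)) := by
  rcases le_or_gt d b with hd | hd
  · rw [max_eq_left (by linarith)]
    have hid : Tendsto (fun z : ℝ => z) (𝓝[>] 0) (𝓝 0) := nhdsWithin_le_nhds
    have h := ((tendsto_const_nhds (x := b - d)).add hid).add
      ((tendsto_tricomiIntegral_add_one_div hb hd).const_mul d)
    rw [mul_zero, add_zero, add_zero] at h
    refine h.congr' ?_
    filter_upwards [self_mem_nhdsWithin] with z hz
    have hI := tricomiIntegral_pos hb hz d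
    have := mul_tricomiIntegral_sub_one hb hz d
    field_simp
    linarith
  · rw [max_eq_right (by linarith)]
    have h := (tendsto_mul_tricomiIntegral_sub_one hb hd).div_const (tricomiIntegral b d 1)
    rw [zero_div] at h
    refine tendsto_of_tendsto_of_tendsto_of_le_of_le' tendsto_const_nhds h ?_ ?_
    · filter_upwards [self_mem_nhdsWithin] with z hz
      have hz : 0 < z := hz
      exact (div_pos (mul_pos hz (tricomiIntegral_pos hb hz _)) (tricomiIntegral_pos hb hz _)).le
    · filter_upwards [Ioc_mem_nhdsGT (zero_lt_one (α := ℝ))] with z hz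
      exact div_le_div_of_nonneg_left (mul_pos hz.1 (tricomiIntegral_pos hb hz.1 _)).le
        (tricomiIntegral_pos hb one_pos _) (tricomiIntegral_le_of_le hb hz.1 hz.2 le_rfl)

/-- `z ^ a` times the Tricomi integral, as a function of `u = -log z`. -/
noncomputable def logTricomi (a b d u : ℝ) : ℝ :=
  Real.exp (-(a * u)) * tricomiIntegral b d (Real.exp (-u))

theorem logTricomi_pos {b : ℝ} (hb : 0 < b) (a d u : ℝ) : 0 < logTricomi a b d u :=
  mul_pos (Real.exp_pos _) (tricomiIntegral_pos hb (Real.exp_pos _) _)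

theorem logTricomi_add_one (a b d u : ℝ) : logTricomi (a + 1) b d u =
    Real.exp (-(a * u)) * (Real.exp (-u) * tricomiIntegral b d (Real.exp (-u))) := by
  rw [logTricomi, show -((a + 1) * u) = -(a * u) + -u by ring, Real.exp_add, mul_assoc]

theorem hasDerivAt_logTricomi {b : ℝ} (hb : 0 < b) (a d u : ℝ) :
    HasDerivAt (logTricomi a b d) (-a * logTricomi a b d u + logTricomi (a + 1) b (d - 1) u) u := by
  have h1 : HasDerivAt (fun u : ℝ => Real.exp (-(a * u))) (Real.exp (-(a * u)) * -a) u :=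
    (((hasDerivAt_id u).const_mul a).fun_neg.congr_deriv (by simp)).exp
  have h2 : HasDerivAt (fun u : ℝ => Real.exp (-u)) (Real.exp (-u) * -1) u :=
    (hasDerivAt_id u).fun_neg.exp
  have h3 := (hasDerivAt_tricomiIntegral hb (Real.exp_pos (-u)) d).comp u h2
  refine (h1.fun_mul h3).congr_deriv ?_
  rw [logTricomi_add_one, logTricomi, Function.comp_apply]
  ring

theorem deriv_logTricomi {b : ℝ} (hb : 0 < b) (a d : ℝ) : deriv (logTricomi a b d) =
    (fun u => -a * logTricomi a b d u) + logTricomi (a + 1) b (d - 1) :=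
  funext fun u => (hasDerivAt_logTricomi hb a d u).deriv

theorem contDiff_logTricomi {b : ℝ} (hb : 0 < b) (a d : ℝ) :
    ContDiff ℝ ∞ (logTricomi a b d) := by
  refine contDiff_infty.2 fun n => ?_
  induction n generalizing a d with
  | zero =>
    exact contDiff_zero.2 (continuous_iff_continuousAt.2 fun u =>
      (hasDerivAt_logTricomi hb a d u).continuousAt)
  | succ n ih =>
    rw [Nat.cast_add_one, contDiff_succ_iff_deriv]
    refine ⟨fun u => (hasDerivAt_logTricomi hb a d u).differentiableAt, ?_, ?_⟩
    · intro h
      exact absurd h (by simp)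
    · rw [deriv_logTricomi hb]
      exact (contDiff_const.mul (ih a d)).add (ih _ _)

theorem tendsto_logTricomi_add_one_div {b : ℝ} (hb : 0 < b) (a d : ℝ) :
    Tendsto (fun u => logTricomi (a + 1) b (d - 1) u / logTricomi a b d u) atTop
      (𝓝 (max (b - d) 0)) := by
  have hexp : Tendsto (fun u : ℝ => Real.exp (-u)) atTop (𝓝[>] 0) :=
    tendsto_nhdsWithin_iff.2
      ⟨Real.tendsto_exp_neg_atTop_nhds_zero, Eventually.of_forall fun u => Real.exp_pos _⟩
  refine ((tendsto_mul_tricomiIntegral_sub_one_div hb d).comp hexp).congr fun u => ?_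
  rw [logTricomi_add_one, logTricomi, mul_div_mul_left _ _ (Real.exp_pos _).ne']
  rfl

theorem tendsto_logTricomi_add_nat_div {b : ℝ} (hb : 0 < b) (a d : ℝ) (j : ℕ) :
    Tendsto (fun u => logTricomi (a + j) b (d - j) u / logTricomi a b d u) atTop
      (𝓝 ((ascPochhammer ℝ j).eval (max (b - d) 0))) := by
  induction j with
  | zero =>
    simp only [Nat.cast_zero, add_zero, sub_zero, ascPochhammer_zero, Polynomial.eval_one]
    exact tendsto_const_nhds.congr fun u => (div_self (logTricomi_pos hb a d u).ne').symm
  | succ j ih =>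
    have h := ih.mul (tendsto_logTricomi_add_one_div hb (a + j) (d - j))
    have hlim : (ascPochhammer ℝ j).eval (max (b - d) 0) * max (b - (d - j)) 0 =
        (ascPochhammer ℝ (j + 1)).eval (max (b - d) 0) := by
      rw [ascPochhammer_succ_eval]
      have hj : (0 : ℝ) ≤ j := j.cast_nonneg
      rcases le_total d b with hd | hd
      · rw [max_eq_left (by linarith), max_eq_left (by linarith)]
        ring
      · rw [max_eq_right (by linarith : b - d ≤ 0)]
        rcases Nat.eq_zero_or_pos j with rfl | hj'
        · simp [hd]
        · rw [ascPochhammer_ne_zero_eval_zero ℝ hj'.ne', zero_mul, zero_mul]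
    rw [hlim] at h
    refine h.congr fun u => ?_
    have h1 := (logTricomi_pos hb (a + j) (d - j) u).ne'
    rw [Nat.cast_add_one, ← add_assoc, ← sub_sub]
    field_simp

theorem tendsto_iteratedDeriv_logTricomi_add_nat_div {b : ℝ} (hb : 0 < b) (a d : ℝ) (n : ℕ) :
    ∀ j : ℕ, Tendsto (fun u => iteratedDeriv n (logTricomi (a + j) b (d - j)) u /
      logTricomi a b d u) atTop
      (𝓝 ((max (b - d) 0 - a) ^ n * (ascPochhammer ℝ j).eval (max (b - d) 0))) := by
  induction n with
  | zero => simpa using tendsto_logTricomi_add_nat_div hb a d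
  | succ n ih =>
    intro j
    have h := ((ih j).const_mul (-(a + j))).add (ih (j + 1))
    rw [ascPochhammer_succ_eval] at h
    convert h using 2
    · rename_i u
      have hc : ∀ a d : ℝ, ContDiffAt ℝ n (logTricomi a b d) u := fun a d =>
        ((contDiff_logTricomi hb a d).of_le (by exact_mod_cast le_top)).contDiffAt
      rw [iteratedDeriv_succ', deriv_logTricomi hb, iteratedDeriv_add
        (contDiffAt_const.mul (hc _ _)) (hc _ _), iteratedDeriv_const_mul_field, Nat.cast_add_one,
        ← add_assoc, ← sub_sub]
      ring
    · ring

theorem tendsto_iteratedDeriv_logTricomi_div {b : ℝ} (hb : 0 < b) (a d : ℝ) (n : ℕ) :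
    Tendsto (fun u => iteratedDeriv n (logTricomi a b d) u / logTricomi a b d u) atTop
      (𝓝 ((max (b - d) 0 - a) ^ n)) := by
  simpa using tendsto_iteratedDeriv_logTricomi_add_nat_div hb a d n 0

theorem HasNonnegDerivDets.logTricomi_sub_one {a b d : ℝ} (hb : 0 < b) (hd : b ≤ d)
    (h : HasNonnegDerivDets (logTricomi a b d)) :
    HasNonnegDerivDets (logTricomi (a + 1) b (d - 1)) := by
  have := h.deriv_sub_mul (σ := -a) (contDiff_logTricomi hb a d)
    (Eventually.of_forall (logTricomi_pos hb a d)) fun n => by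
      simpa [max_eq_right (sub_nonpos.2 hd)] using tendsto_iteratedDeriv_logTricomi_div hb a d n
  convert this using 2 with u
  rw [deriv_logTricomi hb, Pi.add_apply]
  ring

theorem HasNonnegDerivDets.logTricomi_add {a b d : ℝ} (hb : 0 < b) (hd : d ≤ b)
    (h : HasNonnegDerivDets (logTricomi a b d)) :
    HasNonnegDerivDets fun u => logTricomi (a + 1) b d u + d * logTricomi a b (d + 1) u := by
  have := h.deriv_sub_mul (σ := b - d - a) (contDiff_logTricomi hb a d)
    (Eventually.of_forall (logTricomi_pos hb a d)) fun n => by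
      simpa [max_eq_left (sub_nonneg.2 hd)] using tendsto_iteratedDeriv_logTricomi_div hb a d n
  convert this using 2 with u
  have h1 := mul_tricomiIntegral_sub_one hb (Real.exp_pos (-u)) d
  rw [deriv_logTricomi hb, Pi.add_apply, logTricomi_add_one, logTricomi_add_one, logTricomi,
    logTricomi]
  linear_combination -Real.exp (-(a * u)) * h1

theorem HasNonnegDerivDets.logTricomi_pred {a b d : ℝ} (hb : 1 < b) (hd : d ≤ b)
    (h : HasNonnegDerivDets (logTricomi a b d)) : HasNonnegDerivDets (logTricomi a (b - 1) d) := by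
  have hb' : 0 < b - 1 := sub_pos.2 hb
  have := (h.logTricomi_add (by linarith) hd).const_mul (inv_nonneg.2 hb'.le)
  convert this using 2 with u
  have h1 := mul_tricomiIntegral_add_one_add hb' (Real.exp_pos (-u)) d
  rw [sub_add_cancel] at h1
  rw [logTricomi_add_one, logTricomi, logTricomi, eq_inv_mul_iff_mul_eq₀ hb'.ne']
  linear_combination -Real.exp (-(a * u)) * h1

theorem not_hasNonnegDerivDets_logTricomi_add {a b d : ℝ} (hb : 0 < b) (hb1 : b < 1)
    (hd : d < 0) :
    ¬ HasNonnegDerivDets fun u => logTricomi (a + 1) b d u + d * logTricomi a b (d + 1) u := by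
  intro h
  have hlim := (tendsto_logTricomi_add_one_div hb a (d + 1)).add_const d
  have hneg : max (b - (d + 1)) 0 + d < 0 := by
    rcases max_cases (b - (d + 1)) 0 with h | h <;> linarith [h.1]
  obtain ⟨u, hu⟩ := (hlim.eventually (gt_mem_nhds hneg)).exists
  have hpos := logTricomi_pos hb a (d + 1) u
  have := h.nonneg u
  rw [add_sub_cancel_right, div_add' _ _ _ hpos.ne', div_lt_iff₀ hpos] at hu
  linarith

theorem HasNonnegDerivDets.logTricomi_add_sub_one {a b d : ℝ} (hb : 0 < b) (hd0 : 0 < d)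
    (hbd : b < d + 1)
    (h : HasNonnegDerivDets fun u => logTricomi (a + 1) b d u + d * logTricomi a b (d + 1) u) :
    HasNonnegDerivDets fun u =>
      logTricomi (a + 1 + 1) b (d - 1) u + (d - 1) * logTricomi (a + 1) b d u := by
  have hmax : max (b - (d + 1)) 0 = 0 := max_eq_right (by linarith)
  set κ : ℝ → ℝ := fun u => logTricomi (a + 1) b d u + d * logTricomi a b (d + 1) u with hκ
  have hc : ∀ a d : ℝ, ContDiff ℝ ∞ (logTricomi a b d) := contDiff_logTricomi hb
  have hpos : ∀ u, 0 < κ u := fun u =>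
    add_pos (logTricomi_pos hb _ _ _) (mul_pos hd0 (logTricomi_pos hb _ _ _))
  have hquot : ∀ n : ℕ, Tendsto (fun u => iteratedDeriv n κ u / logTricomi a b (d + 1) u) atTop
      (𝓝 (d * (-a) ^ n)) := by
    intro n
    have h0 := tendsto_iteratedDeriv_logTricomi_add_nat_div hb a (d + 1) n 1
    have h1 := (tendsto_iteratedDeriv_logTricomi_div hb a (d + 1) n).const_mul d
    have h2 := h0.add h1
    simp only [hmax, Nat.cast_one, add_sub_cancel_right, ascPochhammer_one, Polynomial.eval_X,
      mul_zero, zero_add, zero_sub] at h2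
    refine h2.congr fun u => ?_
    have hn : ∀ a d : ℝ, ContDiffAt ℝ n (logTricomi a b d) u := fun a d =>
      ((hc a d).of_le (by exact_mod_cast le_top)).contDiffAt
    have : κ = logTricomi (a + 1) b d + fun u => d * logTricomi a b (d + 1) u := rfl
    rw [this, iteratedDeriv_add (hn _ _) (contDiffAt_const.mul (hn _ _)),
      iteratedDeriv_const_mul_field]
    ring
  have hstep := h.deriv_sub_mul (σ := -a) ((hc _ _).add (contDiff_const.mul (hc _ _)))
    (Eventually.of_forall hpos) fun n => by
      have h3 := (hquot n).div (hquot 0) (by simpa using hd0.ne')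
      rw [pow_zero, mul_one, mul_div_cancel_left₀ _ hd0.ne'] at h3
      refine h3.congr fun u => ?_
      rw [iteratedDeriv_zero, Pi.div_apply]
      exact div_div_div_cancel_right₀ (logTricomi_pos hb _ _ _).ne' _ _
  convert hstep using 2 with u
  have hder := (hasDerivAt_logTricomi hb (a + 1) d u).add
    ((hasDerivAt_logTricomi hb a (d + 1) u).const_mul d)
  have : deriv κ u = _ := hder.deriv
  rw [this, hκ, add_sub_cancel_right]
  ring

theorem not_hasNonnegDerivDets_logTricomi (n : ℕ) : ∀ {a b d : ℝ}, 0 < b → ⌈b⌉₊ + ⌈d⌉₊ ≤ n →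
    (¬ ∃ k : ℕ, b = k + 1) → (¬ ∃ k : ℕ, d = k) → ¬ HasNonnegDerivDets (logTricomi a b d) := by
  induction n with
  | zero =>
    intro a b d hb hn
    have := Nat.ceil_pos.2 hb
    omega
  | succ n ih =>
    intro a b d hb hn hbnat hdnat h
    have hb' := Nat.ceil_pos.2 hb
    rcases le_or_gt b d with hbd | hdb
    · have hd : 0 < d := hb.trans_le hbd
      have hd' := Nat.ceil_pos.2 hd
      refine ih hb ?_ hbnat ?_ (h.logTricomi_sub_one hb hbd)
      · rw [Nat.ceil_sub_one]
        omega
      · rintro ⟨k, hk⟩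
        exact hdnat ⟨k + 1, by push_cast; linarith⟩
    rcases lt_trichotomy b 1 with hb1 | rfl | hb1
    · have hadd := h.logTricomi_add hb hdb.le
      rcases lt_trichotomy d 0 with hd | rfl | hd
      · exact not_hasNonnegDerivDets_logTricomi_add hb hb1 hd hadd
      · exact hdnat ⟨0, by simp⟩
      · have hsub := hadd.logTricomi_add_sub_one hb hd (by linarith)
        refine not_hasNonnegDerivDets_logTricomi_add (a := a + 1) (d := d - 1) hb hb1
          (by linarith) ?_
        rwa [sub_add_cancel]
    · exact hbnat ⟨0, by simp⟩
    · refine ih (by linarith) ?_ ?_ hdnat (h.logTricomi_pred hb1 hdb.le)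
      · rw [Nat.ceil_sub_one]
        omega
      · rintro ⟨k, hk⟩
        exact hbnat ⟨k + 1, by push_cast; linarith⟩

theorem kernelT_eq (b d x y : ℝ) :
    kernelT b d x y = (Real.Gamma b)⁻¹ * tricomiIntegral b d (x / y) := by
  rw [kernelT, tricomiF, tricomiIntegral, one_div, mul_left_comm, ← integral_const_mul]
  congr 2 with t
  rw [show -((1 + t) * (x / y)) = -(x / y) + -t * (x / y) by ring, Real.exp_add]
  ring

/-- If `b` is not a positive integer and `d` is not a nonnegative integer, then the
kernel `T_{b,d}` is not totally positive of order infinity. -/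
theorem kernelT_not_TP_infty (b d : ℝ) (hb : 0 < b)
    (hbnat : ¬ ∃ k : ℕ, b = k + 1) (hdnat : ¬ ∃ k : ℕ, d = k) :
    ∃ m : ℕ, 1 ≤ m ∧ ∃ x y : Fin m → ℝ,
      StrictMono x ∧ StrictMono y ∧ (∀ i, 0 < x i) ∧ (∀ i, 0 < y i) ∧
      Matrix.det (Matrix.of fun i j => kernelT b d (x i) (y j)) < 0 := by
  by_contra! hcon
  refine not_hasNonnegDerivDets_logTricomi (a := 0) _ hb le_rfl hbnat hdnat
    (.of_det_nonneg (contDiff_logTricomi hb 0 d) fun m c e hc he => ?_)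
  rcases Nat.eq_zero_or_pos m with rfl | hm
  · simp
  have hmat : (Matrix.of fun i j => kernelT b d (Real.exp (-c i)) (Real.exp (e j))) =
      (Real.Gamma b)⁻¹ • Matrix.of fun i j => logTricomi 0 b d (c i + e j) := by
    ext i j
    rw [Matrix.smul_apply, Matrix.of_apply, Matrix.of_apply, kernelT_eq, logTricomi,
      ← Real.exp_sub, neg_add', zero_mul, neg_zero, Real.exp_zero, one_mul, smul_eq_mul]
  have hdet := hcon m hm (fun i => Real.exp (-c i)) (fun j => Real.exp (e j))
    (fun i j hij => Real.exp_lt_exp.2 (neg_lt_neg (hc hij)))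
    (fun i j hij => Real.exp_lt_exp.2 (he hij)) (fun _ => Real.exp_pos _) fun _ => Real.exp_pos _
  rw [hmat, Matrix.det_smul] at hdet
  exact nonneg_of_mul_nonneg_right hdet
    (pow_pos (inv_pos.2 (Real.Gamma_pos_of_pos hb)) _)
end
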